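/- arXiv:0907.0737 — 4 statements merged into one kernel-verified Lean document; each statement's English description precedes it below -/
import Mathlib

section
/- Let f be a nonconstant homogeneous real polynomial in two variables x, y such that the origin is the unique point of ℝ² at which both partial derivatives ∂f/∂x and ∂f/∂y vanish, and such that f attains its global minimum over ℝ² at the origin. Then there exist an integer k ≥ 1, homogeneous quadratic polynomials Q₁, …, Q_k ∈ ℝ[x,y] that are positive definite (Q_j(x,y) > 0 for all (x,y) ≠ (0,0)) and pairwise non-proportional (for j ≠ j' there is no real constant c with Q_j = c·Q_{j'}), and positive integers β₁, …, β_k, such that f = ∏_{j=1}^{k} Q_j^{β_j}. -/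
open MvPolynomial

lemma aux_hasDeriv (f : MvPolynomial (Fin 2) ℝ) (i : Fin 2) (v : Fin 2 → ℝ) :
    HasDerivAt (fun t : ℝ => eval (Function.update v i t) f) (eval v (pderiv i f)) (v i) := by
  induction f using MvPolynomial.induction_on with
  | C a => simpa using hasDerivAt_const (v i) a
  | add p q hp hq => simpa only [map_add] using! hp.add hq
  | mul_X p j hp =>
    have hX : HasDerivAt (fun t : ℝ => eval (Function.update v i t) (X j : MvPolynomial (Fin 2) ℝ))
        (eval v (pderiv i (X j))) (v i) := by
      by_cases h : j = i
      · subst h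
        simpa using! hasDerivAt_id (v j)
      · simpa [pderiv_X, Pi.single_apply, h, Ne.symm h, Function.update_apply]
          using hasDerivAt_const (v i) (v j)
    have := hp.mul hX
    simp only [Function.update_eq_self] at this
    have e : eval v (pderiv i (p * X j)) =
        eval v (pderiv i p) * eval v (X j) + eval v p * eval v (pderiv i (X j)) := by
      rw [Derivation.leibniz]
      simp only [smul_eq_mul, map_add, map_mul]
      ring
    rw [e]
    simpa only [map_mul] using! this

lemma aux_pderiv_zero (f : MvPolynomial (Fin 2) ℝ) (v : Fin 2 → ℝ)
    (h : ∀ w, eval v f ≤ eval w f) (i : Fin 2) : eval v (pderiv i f) = 0 := by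
  refine IsLocalMin.hasDerivAt_eq_zero (f := fun t : ℝ => eval (Function.update v i t) f) ?_ (aux_hasDeriv f i v)
  refine Filter.Eventually.of_forall fun t => ?_
  simpa using h _

lemma aux_factor (n : ℕ) : ∀ p : Polynomial ℝ, p.natDegree ≤ n → (∀ t, p.eval t ≠ 0) →
    ∃ (c : ℝ) (s : Multiset (ℝ × ℝ)), (∀ x ∈ s, 0 < x.2) ∧
      ∀ t, p.eval t = c * (s.map fun x => (t - x.1) ^ 2 + x.2).prod := by
  induction n using Nat.strong_induction_on with
  | _ n ih =>
  intro p hp h0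
  have hp0 : p ≠ 0 := by rintro rfl; simpa using h0 0
  by_cases hd : p.natDegree = 0
  · obtain ⟨c, rfl⟩ := Polynomial.natDegree_eq_zero.1 hd
    exact ⟨c, 0, by simp, by simp⟩
  · have : 0 < (p.map (algebraMap ℝ ℂ)).degree := by
      rw [Polynomial.degree_map]; exact Polynomial.natDegree_pos_iff_degree_pos.1 (Nat.pos_of_ne_zero hd)
    obtain ⟨z, hz⟩ := Complex.exists_root this
    have hz' : Polynomial.aeval z p = 0 := by
      simpa [Polynomial.IsRoot, Polynomial.eval_map_algebraMap] using hz
    have him : z.im ≠ 0 := by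
      intro him
      have hzr : z = ((z.re : ℝ) : ℂ) := by apply Complex.ext <;> simp [him]
      rw [hzr] at hz'
      have h2 : Polynomial.aeval ((algebraMap ℝ ℂ) z.re) p = 0 := hz'
      rw [Polynomial.aeval_algebraMap_apply] at h2
      exact h0 z.re (by simpa using h2)
    obtain ⟨q, hq⟩ := Polynomial.quadratic_dvd_of_aeval_eq_zero_im_ne_zero p hz' him
    have he : ∀ t, p.eval t = ((t - z.re) ^ 2 + z.im ^ 2) * q.eval t := by
      intro t
      rw [hq]
      simp [Complex.sq_norm, Complex.normSq_apply]
      left; ring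
    have hq0 : q ≠ 0 := by rintro rfl; simp at hq; exact hp0 hq
    set Q : Polynomial ℝ := Polynomial.X ^ 2 - Polynomial.C (2 * z.re) * Polynomial.X + Polynomial.C (‖z‖ ^ 2) with hQ
    have hQd : Q.natDegree = 2 := by rw [hQ]; compute_degree!
    have hQ0 : Q ≠ 0 := by rintro h; simp [h] at hQd
    have hdeg : p.natDegree = 2 + q.natDegree := by
      rw [hq, Polynomial.natDegree_mul hQ0 hq0, hQd]
    obtain ⟨c, s, hs, hse⟩ := ih (n - 1) (by omega) q (by omega) (fun t ht => h0 t (by rw [he, ht, mul_zero]))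
    refine ⟨c, (z.re, z.im ^ 2) ::ₘ s, ?_, fun t => ?_⟩
    · intro x hx
      rcases Multiset.mem_cons.1 hx with rfl | hx
      · simp only; positivity
      · exact hs x hx
    · rw [he, hse]; simp; ring

noncomputable def auxQ (r : ℝ) (x : ℝ × ℝ) : MvPolynomial (Fin 2) ℝ :=
  C r * ((X 0 - C x.1 * X 1) ^ 2 + C x.2 * X 1 ^ 2)

lemma auxQ_hom (r : ℝ) (x : ℝ × ℝ) : (auxQ r x).IsHomogeneous 2 := by
  unfold auxQ
  have h1 : (X 0 - C x.1 * X 1 : MvPolynomial (Fin 2) ℝ).IsHomogeneous 1 :=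
    (isHomogeneous_X _ _).sub (by simpa using (isHomogeneous_C _ x.1).mul (isHomogeneous_X ℝ (1 : Fin 2)))
  have h2 : (C x.2 * X 1 ^ 2 : MvPolynomial (Fin 2) ℝ).IsHomogeneous 2 := by
    simpa using (isHomogeneous_C _ x.2).mul ((isHomogeneous_X ℝ (1 : Fin 2)).pow 2)
  simpa using (isHomogeneous_C _ r).mul ((by simpa using h1.pow 2 : IsHomogeneous _ 2).add h2)

lemma auxQ_eval (r : ℝ) (x : ℝ × ℝ) (v) :
    eval v (auxQ r x) = r * ((v 0 - x.1 * v 1) ^ 2 + x.2 * v 1 ^ 2) := by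
  simp [auxQ]

lemma auxQ_pos (r : ℝ) (hr : 0 < r) (x : ℝ × ℝ) (hx : 0 < x.2) (v : Fin 2 → ℝ) (hv : v ≠ 0) :
    0 < eval v (auxQ r x) := by
  rw [auxQ_eval]
  refine mul_pos hr ?_
  by_cases h : v 1 = 0
  · have : v 0 ≠ 0 := by
      intro h0; apply hv; ext i; fin_cases i <;> simp [h, h0]
    simp [h]; positivity
  · positivity

lemma auxQ_ne (r : ℝ) (hr : 0 < r) (x y : ℝ × ℝ) (c : ℝ) (h : auxQ r x = c • auxQ r y) : x = y := by
  have h1 := congrArg (eval ![1, 0]) h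
  have h2 := congrArg (eval ![0, 1]) h
  have h3 := congrArg (eval ![1, 1]) h
  simp [smul_eval, auxQ_eval] at h1 h2 h3
  have hc : c = 1 := by
    have : r * (c - 1) = 0 := by linarith
    rcases mul_eq_zero.1 this with h | h <;> linarith
  subst hc
  simp [hr.ne'] at h2 h3
  have : x.1 = y.1 := by linarith
  exact Prod.ext this (by rw [this] at h2; linarith)

lemma aux_homog (f : MvPolynomial (Fin 2) ℝ) (m : ℕ) (hf : f.IsHomogeneous m) (w : ℝ)
    (v : Fin 2 → ℝ) : eval (fun i => w * v i) f = w ^ m * eval v f := by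
  rw [eval_eq', eval_eq', Finset.mul_sum]
  refine Finset.sum_congr rfl fun d hd => ?_
  have hdm : d 0 + d 1 = m := by
    have := hf (mem_support_iff.1 hd)
    simpa [Finsupp.weight_apply, Finsupp.sum_fintype] using this
  rw [← hdm]
  simp only [Fin.prod_univ_two]
  ring

lemma aux_prod_eval (s : Multiset (ℝ × ℝ)) (r : ℝ) (v : Fin 2 → ℝ) :
    eval v (s.map (auxQ r)).prod =
      (s.map fun x => r * ((v 0 - x.1 * v 1) ^ 2 + x.2 * v 1 ^ 2)).prod := by
  induction s using Multiset.induction_on with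
  | empty => simp
  | cons a s ih => simp [ih, auxQ_eval]

lemma aux_prod_scale (s : Multiset (ℝ × ℝ)) (r : ℝ) :
    (s.map (auxQ r)).prod = C (r ^ s.card) * (s.map (auxQ 1)).prod := by
  induction s using Multiset.induction_on with
  | empty => simp
  | cons a s ih =>
    simp only [Multiset.map_cons, Multiset.prod_cons, ih, Multiset.card_cons, pow_succ, C_mul]
    have : auxQ r a = C r * auxQ 1 a := by simp [auxQ]
    rw [this]; ring

lemma aux_prod_dehom (s : Multiset (ℝ × ℝ)) (u w : ℝ) (hw : w ≠ 0) :
    (s.map fun x => 1 * ((u - x.1 * w) ^ 2 + x.2 * w ^ 2)).prod =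
      w ^ (2 * s.card) * (s.map fun x => (u / w - x.1) ^ 2 + x.2).prod := by
  induction s using Multiset.induction_on with
  | empty => simp
  | cons a s ih =>
    simp only [Multiset.map_cons, Multiset.prod_cons, ih, Multiset.card_cons]
    have : 1 * ((u - a.1 * w) ^ 2 + a.2 * w ^ 2) = w ^ 2 * ((u / w - a.1) ^ 2 + a.2) := by
      field_simp
    rw [this]; ring

lemma aux_dehom (f : MvPolynomial (Fin 2) ℝ) (t : ℝ) :
    (aeval ![Polynomial.X, 1] f : Polynomial ℝ).eval t = eval ![t, 1] f := by
  induction f using MvPolynomial.induction_on with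
  | C a => simp
  | add p q hp hq => simp [hp, hq]
  | mul_X p j hp =>
    rw [map_mul, Polynomial.eval_mul, hp, map_mul]
    fin_cases j <;> simp

lemma aux_main (f : MvPolynomial (Fin 2) ℝ) (m : ℕ) (hf : f.IsHomogeneous m)
    (hpos : ∀ v : Fin 2 → ℝ, v ≠ 0 → 0 < eval v f) :
    ∃ (c : ℝ) (s : Multiset (ℝ × ℝ)), 0 < c ∧ (∀ x ∈ s, 0 < x.2) ∧ m = 2 * s.card ∧
      f = C c * (s.map (auxQ 1)).prod := by
  have hpe : ∀ t : ℝ, (aeval ![Polynomial.X, 1] f : Polynomial ℝ).eval t = eval ![t, 1] f := by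
    intro t
    exact aux_dehom f t
  obtain ⟨c, s, hs, hse⟩ := aux_factor _ (aeval ![Polynomial.X, 1] f : Polynomial ℝ) le_rfl
    (fun t => by
      rw [hpe]
      refine (hpos _ fun h => ?_).ne'
      simpa using congrFun h 1)
  have hprod : ∀ t : ℝ, 0 < (s.map fun x => (t - x.1) ^ 2 + x.2).prod := by
    intro t
    refine Multiset.prod_pos fun y hy => ?_
    obtain ⟨x, hx, rfl⟩ := Multiset.mem_map.1 hy
    have := hs x hx
    positivity
  have hc : 0 < c := by
    have h1 : 0 < eval ![0, 1] f := hpos _ fun h => by simpa using congrFun h 1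
    rw [← hpe, hse] at h1
    exact (pos_iff_pos_of_mul_pos h1).2 (hprod 0)
  set g := C c * (s.map (auxQ 1)).prod with hg
  have key : X 1 ^ (2 * s.card + 1) * f = X 1 ^ (m + 1) * g := by
    refine MvPolynomial.funext fun v => ?_
    by_cases hw : v 1 = 0
    · simp [hw]
    have hv : v = fun i => v 1 * (![v 0 / v 1, 1] : Fin 2 → ℝ) i := by
      ext i; fin_cases i
      · simp; field_simp
      · simp
    have h1 : eval v f = v 1 ^ m * eval ![v 0 / v 1, 1] f := by
      rw [← aux_homog f m hf, ← hv]
    simp only [map_mul, map_pow, eval_X, hg, eval_C, aux_prod_eval, aux_prod_dehom s _ _ hw, h1,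
      ← hpe, hse]
    ring
  have hX : (X 1 : MvPolynomial (Fin 2) ℝ) ≠ 0 := X_ne_zero _
  have hf1 : eval ![1, 0] f ≠ 0 := (hpos _ fun h => by simpa using congrFun h 0).ne'
  have hg1 : eval ![1, 0] g ≠ 0 := by simp [hg, aux_prod_eval, hc.ne']
  have hm : m = 2 * s.card := by
    rcases lt_trichotomy m (2 * s.card) with h | h | h
    · exfalso
      obtain ⟨d, hd⟩ := Nat.exists_eq_add_of_lt h
      have e : X 1 ^ (m + 1) * (X 1 ^ (d + 1) * f) = X 1 ^ (m + 1) * g := by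
        rw [← key, hd]; ring
      have e2 := congrArg (eval ![1, 0]) (mul_left_cancel₀ (pow_ne_zero _ hX) e)
      simp at e2
      exact hg1 e2.symm
    · exact h
    · exfalso
      obtain ⟨d, hd⟩ := Nat.exists_eq_add_of_lt h
      have e : X 1 ^ (2 * s.card + 1) * f = X 1 ^ (2 * s.card + 1) * (X 1 ^ (d + 1) * g) := by
        rw [key, hd]; ring
      have e2 := congrArg (eval ![1, 0]) (mul_left_cancel₀ (pow_ne_zero _ hX) e)
      simp at e2
      exact hf1 e2
  refine ⟨c, s, hc, hs, hm, ?_⟩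
  rw [← hm] at key
  exact mul_left_cancel₀ (pow_ne_zero _ hX) key

/-- a nonconstant homogeneous real polynomial in two variables whose partial
derivatives vanish simultaneously only at the origin and which attains its global minimum at
the origin is a product of powers of pairwise non-proportional positive definite quadratic
forms. -/
theorem homogeneous_poly_product_of_quadratic_forms
    (f : MvPolynomial (Fin 2) ℝ)
    (hhom : ∃ m : ℕ, f.IsHomogeneous m)
    (hnonconst : ¬ ∃ c : ℝ, f = C c)
    (hcrit : ∀ v : Fin 2 → ℝ,
      (eval v (pderiv (0 : Fin 2) f) = 0 ∧ eval v (pderiv (1 : Fin 2) f) = 0) ↔ v = 0)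
    (hmin : ∀ v : Fin 2 → ℝ, eval (0 : Fin 2 → ℝ) f ≤ eval v f) :
    ∃ k : ℕ, 1 ≤ k ∧
      ∃ (Q : Fin k → MvPolynomial (Fin 2) ℝ) (β : Fin k → ℕ),
        (∀ j, (Q j).IsHomogeneous 2) ∧
        (∀ j, ∀ v : Fin 2 → ℝ, v ≠ 0 → 0 < eval v (Q j)) ∧
        (∀ j j', j ≠ j' → ∀ c : ℝ, Q j ≠ c • Q j') ∧
        (∀ j, 1 ≤ β j) ∧
        f = ∏ j, Q j ^ β j := by
  obtain ⟨m, hf⟩ := hhom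
  have hm0 : m ≠ 0 := by
    rintro rfl
    exact hnonconst ⟨_, totalDegree_eq_zero_iff_eq_C.1 ((totalDegree_zero_iff_isHomogeneous _).2 hf)⟩
  have hf0 : eval (0 : Fin 2 → ℝ) f = 0 := by
    have := aux_homog f m hf 0 0
    rw [zero_pow hm0, zero_mul] at this
    simpa [← Pi.zero_def] using this
  have hpos : ∀ v : Fin 2 → ℝ, v ≠ 0 → 0 < eval v f := by
    intro v hv
    refine lt_of_le_of_ne (hf0 ▸ hmin v) fun h => hv ?_
    have hvm : ∀ w, eval v f ≤ eval w f := fun w => by rw [← h, ← hf0]; exact hmin w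
    exact (hcrit v).1 ⟨aux_pderiv_zero f v hvm 0, aux_pderiv_zero f v hvm 1⟩
  obtain ⟨c, s, hc, hs, hm, hfe⟩ := aux_main f m hf hpos
  have hcard : s.card ≠ 0 := by omega
  set r : ℝ := c ^ ((s.card : ℝ)⁻¹) with hr
  have hr0 : 0 < r := Real.rpow_pos_of_pos hc _
  have hrc : r ^ s.card = c := Real.rpow_inv_natCast_pow hc.le hcard
  rw [← hrc, ← aux_prod_scale] at hfe
  classical
  let e := s.toFinset.equivFin
  have hmem : ∀ j, (e.symm j : ℝ × ℝ) ∈ s := fun j => Multiset.mem_toFinset.1 (e.symm j).2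
  refine ⟨s.toFinset.card, ?_, fun j => auxQ r (e.symm j), fun j => s.count (e.symm j : ℝ × ℝ),
    fun j => auxQ_hom _ _, fun j v hv => auxQ_pos r hr0 _ (hs _ (hmem j)) v hv, ?_, ?_, ?_⟩
  · obtain ⟨x, hx⟩ := Multiset.card_pos_iff_exists_mem.1 (Nat.pos_of_ne_zero hcard)
    exact Finset.card_pos.2 ⟨x, Multiset.mem_toFinset.2 hx⟩
  · intro j j' hj c' h
    exact hj (e.symm.injective (Subtype.ext (auxQ_ne r hr0 _ _ c' h)))
  · intro j
    exact Multiset.one_le_count_iff_mem.2 (hmem j)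
  · rw [hfe, Finset.prod_multiset_map_count, ← Finset.prod_coe_sort]
    exact (Equiv.prod_comp e.symm (fun x : s.toFinset => auxQ r x ^ s.count (x : ℝ × ℝ))).symm
end

section
/- Let f = ∏_{j=1}^{k} Q_j^{β_j} ∈ ℝ[x,y], where k ≥ 1, each Q_j is a positive definite homogeneous quadratic polynomial, the Q_j are pairwise non-proportional (for j ≠ j' there is no real constant c with Q_j = c·Q_{j'}), and each β_j ≥ 1 is an integer. Then D := ∏_{j=1}^{k} Q_j^{β_j − 1} is a greatest common divisor of the partial derivatives ∂f/∂x and ∂f/∂y in the ring ℝ[x,y]: D divides both ∂f/∂x and ∂f/∂y, and every polynomial dividing both ∂f/∂x and ∂f/∂y divides D. -/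
open MvPolynomial

lemma aux_linear (q : MvPolynomial (Fin 2) ℝ) (h : q.totalDegree ≤ 1) :
    ∃ a b c : ℝ, q = C a + C b * X 0 + C c * X 1 := by
  classical
  have hsub : q.support ⊆ ({0, Finsupp.single 0 1, Finsupp.single 1 1} : Finset (Fin 2 →₀ ℕ)) := by
    intro s hs
    have h1 := (le_totalDegree hs).trans h
    rw [Finsupp.sum_fintype _ _ (by simp), Fin.sum_univ_two] at h1
    have h2 : (s 0 = 0 ∧ s 1 = 0) ∨ (s 0 = 1 ∧ s 1 = 0) ∨ (s 0 = 0 ∧ s 1 = 1) := by lia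
    simp only [Finset.mem_insert, Finset.mem_singleton]
    rcases h2 with h2 | h2 | h2
    · left; ext i; fin_cases i <;> simp [h2.1, h2.2]
    · right; left; ext i; fin_cases i <;> simp [h2.1, h2.2]
    · right; right; ext i; fin_cases i <;> simp [h2.1, h2.2]
  refine ⟨coeff 0 q, coeff (Finsupp.single 0 1) q, coeff (Finsupp.single 1 1) q, ?_⟩
  conv_lhs => rw [q.as_sum]
  rw [Finset.sum_subset hsub (by
    intro x _ hx
    rw [notMem_support_iff.mp hx, monomial_zero])]
  rw [Finset.sum_insert, Finset.sum_insert, Finset.sum_singleton]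
  · rw [← C_mul_X_eq_monomial, ← C_mul_X_eq_monomial, add_assoc]; rfl
  · simp [Finsupp.single_left_inj]
  · simp only [Finset.mem_insert, Finset.mem_singleton, not_or]
    constructor <;> · intro h; simpa using h.symm

lemma aux_zero (q : MvPolynomial (Fin 2) ℝ) (h : q.totalDegree = 1) :
    ∃ v : Fin 2 → ℝ, v ≠ 0 ∧ eval v q = 0 := by
  obtain ⟨a, b, c, rfl⟩ := aux_linear q h.le
  by_cases hbc : b = 0 ∧ c = 0
  · obtain ⟨rfl, rfl⟩ := hbc
    simp at h
  have hpos : b ^ 2 + c ^ 2 ≠ 0 := by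
    intro h0
    exact hbc ⟨by nlinarith [sq_nonneg b, sq_nonneg c], by nlinarith [sq_nonneg b, sq_nonneg c]⟩
  by_cases ha : a = 0
  · refine ⟨![-c, b], ?_, ?_⟩
    · intro h0
      have h1 := congrFun h0 0
      have h2 := congrFun h0 1
      simp at h1 h2
      exact hbc ⟨h2, h1⟩
    · simp [ha]; ring
  · have key : eval ![-a / (b ^ 2 + c ^ 2) * b, -a / (b ^ 2 + c ^ 2) * c]
      (C a + C b * X 0 + C c * X 1 : MvPolynomial (Fin 2) ℝ) = 0 := by
      simp; field_simp; ring
    refine ⟨_, ?_, key⟩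
    intro h0
    rw [h0] at key
    simp at key
    exact ha key

lemma aux_ne (Q : MvPolynomial (Fin 2) ℝ)
    (hp : ∀ v : Fin 2 → ℝ, v ≠ 0 → 0 < eval v Q) : Q ≠ 0 := by
  rintro rfl
  have := hp 1 one_ne_zero
  simp at this

lemma aux_irr (Q : MvPolynomial (Fin 2) ℝ) (hh : Q.IsHomogeneous 2)
    (hp : ∀ v : Fin 2 → ℝ, v ≠ 0 → 0 < eval v Q) : Irreducible Q := by
  have h0 := aux_ne Q hp
  have hd := hh.totalDegree h0
  have hu : ∀ a : MvPolynomial (Fin 2) ℝ, a ≠ 0 → a.totalDegree = 0 → IsUnit a := by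
    intro a ha h
    rw [totalDegree_eq_zero_iff_eq_C] at h
    rw [h] at ha ⊢
    exact (IsUnit.mk0 _ (fun h => ha (by rw [h, C_0]))).map C
  refine ⟨fun h => ?_, ?_⟩
  · have := (isUnit_iff_totalDegree_of_isReduced.mp h).2
    lia
  · rintro a b rfl
    have ha := left_ne_zero_of_mul h0
    have hb := right_ne_zero_of_mul h0
    rw [totalDegree_mul_of_isDomain ha hb] at hd
    have : a.totalDegree = 0 ∨ b.totalDegree = 0 ∨ a.totalDegree = 1 := by lia
    rcases this with h | h | h
    · exact Or.inl (hu a ha h)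
    · exact Or.inr (hu b hb h)
    · obtain ⟨v, hv, hv0⟩ := aux_zero a h
      have := hp v hv
      simp [hv0] at this

lemma aux_prod {ι : Type*} [DecidableEq ι] (s : Finset ι) (g : ι → MvPolynomial (Fin 2) ℝ)
    (i : Fin 2) :
    pderiv i (∏ j ∈ s, g j) = ∑ j ∈ s, (∏ l ∈ s.erase j, g l) * pderiv i (g j) := by
  induction s using Finset.induction_on with
  | empty => simp
  | insert a s ha ih =>
    rw [Finset.prod_insert ha, pderiv_mul, ih, Finset.sum_insert ha, Finset.erase_insert ha,
      Finset.mul_sum, mul_comm]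
    congr 1
    refine Finset.sum_congr rfl fun j hj => ?_
    rw [Finset.erase_insert_of_ne (by rintro rfl; exact ha hj),
      Finset.prod_insert (by simp [ha]), mul_assoc]

lemma aux_fact {k : ℕ} (Q : Fin k → MvPolynomial (Fin 2) ℝ) (β : Fin k → ℕ)
    (hβ : ∀ j, 1 ≤ β j) (i : Fin 2) :
    pderiv i (∏ j, Q j ^ β j) = (∏ j, Q j ^ (β j - 1)) *
      ∑ j, (∏ l ∈ Finset.univ.erase j, Q l) * ((β j : MvPolynomial (Fin 2) ℝ) * pderiv i (Q j)) := by
  rw [aux_prod, Finset.mul_sum]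
  refine Finset.sum_congr rfl fun j _ => ?_
  have h1 : ∏ l ∈ Finset.univ.erase j, Q l ^ β l =
      (∏ l ∈ Finset.univ.erase j, Q l ^ (β l - 1)) * ∏ l ∈ Finset.univ.erase j, Q l := by
    rw [← Finset.prod_mul_distrib]
    refine Finset.prod_congr rfl fun l _ => ?_
    rw [← pow_succ, Nat.sub_add_cancel (hβ l)]
  rw [h1, pderiv_pow, ← Finset.mul_prod_erase Finset.univ (fun l => Q l ^ (β l - 1))
    (Finset.mem_univ j)]
  ring

lemma aux_euler (Q : MvPolynomial (Fin 2) ℝ) (hh : Q.IsHomogeneous 2) :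
    X 0 * pderiv 0 Q + X 1 * pderiv 1 Q = 2 * Q := by
  have := hh.sum_X_mul_pderiv
  rw [Fin.sum_univ_two] at this
  rw [this, nsmul_eq_mul]; norm_num

lemma aux_not_dvd_pderiv (Q : MvPolynomial (Fin 2) ℝ) (hh : Q.IsHomogeneous 2)
    (hp : ∀ v : Fin 2 → ℝ, v ≠ 0 → 0 < eval v Q) : ¬ Q ∣ pderiv 0 Q := by
  have h0 := aux_ne Q hp
  intro hdvd
  have hne : pderiv 0 Q ≠ 0 := by
    intro hz
    have h1 := congrArg (eval ![1, 0]) (aux_euler Q hh)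
    have h2 := hp ![1, 0] (by intro h; simpa using congrFun h 0)
    simp [hz] at h1
    linarith
  have h1 := hh.totalDegree h0
  have h2 := (hh.pderiv (i := 0)).totalDegree hne
  obtain ⟨r, hr⟩ := hdvd
  rw [hr] at hne
  have h3 := totalDegree_mul_of_isDomain h0 (right_ne_zero_of_mul hne)
  rw [← hr] at h3
  lia

lemma aux_dvd (P Q : MvPolynomial (Fin 2) ℝ) (hP : P.IsHomogeneous 2) (hQ : Q.IsHomogeneous 2)
    (hP0 : P ≠ 0) (hQ0 : Q ≠ 0) (h : P ∣ Q) : ∃ c : ℝ, Q = c • P := by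
  obtain ⟨r, rfl⟩ := h
  have h1 := hP.totalDegree hP0
  have h2 := hQ.totalDegree hQ0
  rw [totalDegree_mul_of_isDomain hP0 (right_ne_zero_of_mul hQ0)] at h2
  have h3 : r.totalDegree = 0 := by lia
  rw [totalDegree_eq_zero_iff_eq_C] at h3
  exact ⟨coeff 0 r, by rw [smul_eq_C_mul, ← h3, mul_comm]⟩

/-- for `f = ∏ Q_j ^ β_j` a product of powers of pairwise non-proportional
positive definite quadratic forms, `D = ∏ Q_j ^ (β_j − 1)` is a greatest common divisor of
the two partial derivatives of `f` in `ℝ[x,y]`. -/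
theorem gcd_of_partial_derivatives
    (k : ℕ) (hk : 1 ≤ k)
    (Q : Fin k → MvPolynomial (Fin 2) ℝ) (β : Fin k → ℕ)
    (hQhom : ∀ j, (Q j).IsHomogeneous 2)
    (hQpos : ∀ j, ∀ v : Fin 2 → ℝ, v ≠ 0 → 0 < eval v (Q j))
    (hQnonprop : ∀ j j', j ≠ j' → ∀ c : ℝ, Q j ≠ c • Q j')
    (hβ : ∀ j, 1 ≤ β j)
    (f D : MvPolynomial (Fin 2) ℝ)
    (hf : f = ∏ j, Q j ^ β j)
    (hD : D = ∏ j, Q j ^ (β j - 1)) :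
    D ∣ pderiv (0 : Fin 2) f ∧ D ∣ pderiv (1 : Fin 2) f ∧
      ∀ p : MvPolynomial (Fin 2) ℝ,
        p ∣ pderiv (0 : Fin 2) f → p ∣ pderiv (1 : Fin 2) f → p ∣ D := by
  classical
  set G : Fin 2 → MvPolynomial (Fin 2) ℝ := fun i =>
    ∑ j, (∏ l ∈ Finset.univ.erase j, Q l) * ((β j : MvPolynomial (Fin 2) ℝ) * pderiv i (Q j))
    with hG
  have hfG : ∀ i, pderiv i f = D * G i := fun i => by
    rw [hf, hD, aux_fact Q β hβ]
  have hirr := fun j => aux_irr (Q j) (hQhom j) (hQpos j)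
  have hEuler : X 0 * G 0 + X 1 * G 1 =
      C (2 * ((∑ j, β j : ℕ) : ℝ)) * ∏ j, Q j := by
    simp only [hG, Finset.mul_sum, ← Finset.sum_add_distrib, Nat.cast_sum, map_sum,
      Finset.sum_mul]
    refine Finset.sum_congr rfl fun j _ => ?_
    rw [← Finset.mul_prod_erase Finset.univ Q (Finset.mem_univ j)]
    have := aux_euler (Q j) (hQhom j)
    simp only [map_mul, map_natCast, map_ofNat]
    linear_combination (∏ l ∈ Finset.univ.erase j, Q l) * (β j : MvPolynomial (Fin 2) ℝ) * this
  have hN : (2 * ((∑ j, β j : ℕ) : ℝ)) ≠ 0 := by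
    have h1 : 1 ≤ ∑ j, β j := (hβ ⟨0, hk⟩).trans
      (Finset.single_le_sum (f := β) (fun _ _ => Nat.zero_le _) (Finset.mem_univ _))
    have h2 : (1 : ℝ) ≤ ((∑ j, β j : ℕ) : ℝ) := by exact_mod_cast h1
    linarith
  have hprod : ∏ j, Q j ≠ 0 := Finset.prod_ne_zero_iff.mpr fun j _ => (hirr j).ne_zero
  have hCu : IsUnit (C (2 * ((∑ j, β j : ℕ) : ℝ)) : MvPolynomial (Fin 2) ℝ) :=
    (IsUnit.mk0 _ hN).map C
  have hrel : IsRelPrime (G 0) (G 1) := by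
    intro d hd0 hd1
    by_contra hdu
    have hd : d ∣ ∏ j, Q j := by
      have := dvd_add (hd0.mul_left (X 0)) (hd1.mul_left (X 1))
      rw [hEuler] at this
      exact hCu.dvd_mul_left.mp this
    obtain ⟨q, hq, hqd⟩ := WfDvdMonoid.exists_irreducible_factor hdu (ne_zero_of_dvd_ne_zero hprod hd)
    obtain ⟨l, -, hl⟩ := hq.prime.exists_mem_finset_dvd (hqd.trans hd)
    have hQG : Q l ∣ G 0 := ((hq.associated_of_dvd (hirr l) hl).symm.dvd).trans (hqd.trans hd0)
    simp only [hG] at hQG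
    rw [← Finset.add_sum_erase _ _ (Finset.mem_univ l)] at hQG
    rw [dvd_add_left] at hQG
    · rcases (hirr l).prime.dvd_or_dvd hQG with h | h
      · obtain ⟨m, hm, h⟩ := (hirr l).prime.exists_mem_finset_dvd h
        obtain ⟨c, hc⟩ := aux_dvd _ _ (hQhom l) (hQhom m) (hirr l).ne_zero (hirr m).ne_zero h
        exact hQnonprop m l (Finset.ne_of_mem_erase hm) c hc
      · have hb : IsUnit (β l : MvPolynomial (Fin 2) ℝ) := by
          have : ((β l : ℕ) : ℝ) ≠ 0 := by have := hβ l; positivity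
          simpa using (IsUnit.mk0 _ this).map (C : ℝ →+* MvPolynomial (Fin 2) ℝ)
        exact aux_not_dvd_pderiv _ (hQhom l) (hQpos l) (hb.dvd_mul_left.mp h)
    · refine Finset.dvd_sum fun j hj => Dvd.dvd.mul_right (Finset.dvd_prod_of_mem Q ?_) _
      exact Finset.mem_erase.mpr ⟨(Finset.ne_of_mem_erase hj).symm, Finset.mem_univ _⟩
  rw [hfG, hfG]
  refine ⟨dvd_mul_right _ _, dvd_mul_right _ _, fun p h0 h1 => ?_⟩
  letI := UniqueFactorizationMonoid.toGCDMonoid (MvPolynomial (Fin 2) ℝ)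
  have h := (dvd_gcd h0 h1).trans (gcd_mul_left' D (G 0) (G 1)).dvd
  exact (gcd_isUnit_iff_isRelPrime.mpr hrel).dvd_mul_right.mp h
end

section
/- Let n ≥ 1, let F : ℝⁿ → ℝⁿ be a C^∞ vector field, and let φ : ℝⁿ × ℝ → ℝⁿ be a C^∞ map satisfying φ(z,0) = z, φ(φ(z,s),t) = φ(z,s+t), and (∂φ/∂t)(z,t) = F(φ(z,t)) for all z ∈ ℝⁿ and s,t ∈ ℝ (i.e. φ is the flow of F). Let α : ℝⁿ → ℝ be a C^∞ function and define h : ℝⁿ → ℝⁿ by h(z) = φ(z, α(z)). Then for every point z₀ ∈ ℝⁿ, the Fréchet derivative Dh(z₀) : ℝⁿ → ℝⁿ is a linear isomorphism (equivalently, h is a local diffeomorphism at z₀) if and only if Dα(z₀)(F(z₀)) ≠ −1. -/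
/-- if `h(z) = φ(z, α(z))` is a shift along the flow `φ` of a smooth vector
field `F` via a smooth function `α`, then `h` is a local diffeomorphism at `z₀` (i.e. its
Fréchet derivative at `z₀` is a linear isomorphism) iff `Dα(z₀)(F(z₀)) ≠ −1`. -/
theorem shift_local_diffeo_iff
    (n : ℕ) (hn : 1 ≤ n)
    (F : EuclideanSpace ℝ (Fin n) → EuclideanSpace ℝ (Fin n))
    (hF : ContDiff ℝ (⊤ : ℕ∞) F)
    (φ : EuclideanSpace ℝ (Fin n) → ℝ → EuclideanSpace ℝ (Fin n))
    (hφ : ContDiff ℝ (⊤ : ℕ∞) (fun p : EuclideanSpace ℝ (Fin n) × ℝ => φ p.1 p.2))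
    (hφ0 : ∀ z, φ z 0 = z)
    (hφadd : ∀ z s t, φ (φ z s) t = φ z (s + t))
    (hφF : ∀ z t, HasDerivAt (φ z) (F (φ z t)) t)
    (α : EuclideanSpace ℝ (Fin n) → ℝ) (hα : ContDiff ℝ (⊤ : ℕ∞) α)
    (h : EuclideanSpace ℝ (Fin n) → EuclideanSpace ℝ (Fin n))
    (hh : ∀ z, h z = φ z (α z))
    (z₀ : EuclideanSpace ℝ (Fin n)) :
    Function.Bijective (fderiv ℝ h z₀) ↔ fderiv ℝ α z₀ (F z₀) ≠ -1 := by
  have hd : Differentiable ℝ (fun p : EuclideanSpace ℝ (Fin n) × ℝ => φ p.1 p.2) :=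
    hφ.differentiable (by simp)
  have hαd : HasFDerivAt α (fderiv ℝ α z₀) z₀ :=
    (hα.differentiable (by simp) z₀).hasFDerivAt
  have hslice : ∀ (t : ℝ) z, DifferentiableAt ℝ (fun w => φ w t) z := fun t z =>
    (hd (z, t)).comp (f := fun w : EuclideanSpace ℝ (Fin n) => (w, t)) z (by fun_prop)
  set a := α z₀ with ha
  obtain ⟨A, hA⟩ : ∃ A, HasFDerivAt (fun w => φ w a) A z₀ := ⟨_, (hslice a z₀).hasFDerivAt⟩
  obtain ⟨B, hB⟩ : ∃ B, HasFDerivAt (fun w => φ w (-a)) B (φ z₀ a) :=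
    ⟨_, (hslice (-a) _).hasFDerivAt⟩
  have hBA : ∀ v, B (A v) = v := by
    have h1 := HasFDerivAt.comp (g := fun w => φ w (-a)) z₀ hB hA
    have h2 : ((fun w => φ w (-a)) ∘ fun w => φ w a) = id := by
      funext w
      simp [hφadd, hφ0]
    rw [h2] at h1
    have h3 := h1.unique (hasFDerivAt_id z₀)
    intro v
    simpa using congrArg (fun L => L v) h3
  have hAF : A (F z₀) = F (φ z₀ a) := by
    have hA' : HasFDerivAt (fun w => φ w a) A (φ z₀ 0) := by rw [hφ0]; exact hA
    have h1 := hA'.comp_hasDerivAt (0 : ℝ) (hφF z₀ 0)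
    have h2 : ((fun w => φ w a) ∘ φ z₀) = fun t => φ z₀ (t + a) := by
      funext t
      simp [hφadd]
    rw [h2, hφ0] at h1
    have h3 : HasDerivAt (fun t => φ z₀ (t + a)) (F (φ z₀ (0 + a))) 0 :=
      HasDerivAt.comp_add_const 0 a (hφF z₀ (0 + a))
    rw [zero_add] at h3
    exact h1.unique h3
  have hD : ∀ v, fderiv ℝ h z₀ v = A v + fderiv ℝ α z₀ v • F (φ z₀ a) := by
    obtain ⟨L, hL⟩ : ∃ L, HasFDerivAt
        (fun p : EuclideanSpace ℝ (Fin n) × ℝ => φ p.1 p.2) L (z₀, a) :=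
      ⟨_, (hd (z₀, a)).hasFDerivAt⟩
    have e1 : ∀ v, L (v, 0) = A v := by
      have h1 : HasFDerivAt (fun w => φ w a) _ z₀ :=
        HasFDerivAt.comp (f := fun w : EuclideanSpace ℝ (Fin n) => (w, a)) z₀ hL
          ((hasFDerivAt_id z₀).prodMk (hasFDerivAt_const a z₀))
      intro v
      simpa using congrArg (fun L => L v) (h1.unique hA)
    have e2 : L (0, 1) = F (φ z₀ a) := by
      have h1 : HasDerivAt (φ z₀) _ a :=
        HasFDerivAt.comp_hasDerivAt (f := fun t : ℝ => (z₀, t)) a hL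
          ((hasDerivAt_const a z₀).prodMk (hasDerivAt_id a))
      exact h1.unique (hφF z₀ a)
    have h1 : HasFDerivAt (fun w => φ w (α w)) _ z₀ :=
      HasFDerivAt.comp (f := fun w : EuclideanSpace ℝ (Fin n) => (w, α w)) z₀ hL
        ((hasFDerivAt_id z₀).prodMk hαd)
    have h2 : h = fun w => φ w (α w) := funext hh
    intro v
    rw [h2, h1.fderiv, ← e1, ← e2, ← map_smul, ← map_add]
    simp
  constructor
  · intro hb hc
    have h0 : fderiv ℝ h z₀ (F z₀) = fderiv ℝ h z₀ 0 := by
      rw [hD, hAF, hc, map_zero]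
      simp
    have h1 := hb.1 h0
    rw [h1, map_zero] at hc
    norm_num at hc
  · intro hc
    have hinj : Function.Injective (fderiv ℝ h z₀ :
        EuclideanSpace ℝ (Fin n) →ₗ[ℝ] EuclideanSpace ℝ (Fin n)) := by
      rw [injective_iff_map_eq_zero]
      intro v hv
      have hv' : A v + fderiv ℝ α z₀ v • F (φ z₀ a) = 0 := by rw [← hD]; exact hv
      have h1 : v + fderiv ℝ α z₀ v • F z₀ = 0 := by
        have := congrArg B hv'
        rwa [← hAF, map_add, map_smul, hBA, hBA, map_zero] at this
      have h2 := congrArg (fderiv ℝ α z₀) h1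
      rw [map_add, map_smul, map_zero, smul_eq_mul] at h2
      have h3 : fderiv ℝ α z₀ v * (1 + fderiv ℝ α z₀ (F z₀)) = 0 := by linarith
      have h4 : fderiv ℝ α z₀ v = 0 := by
        rcases mul_eq_zero.1 h3 with h | h
        · exact h
        · exact absurd (by linarith) hc
      simpa [h4] using h1
    exact ⟨hinj, LinearMap.injective_iff_surjective.1 hinj⟩
end

section
/- Let (F, φ) be a TC flow on D² admitting a first strong integral f, and let h ∈ E(F). Then there exist g ∈ D(F) and an open neighborhood U of O in D² such that h(z) = g(z) for all z ∈ U. -/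
open Set

noncomputable section

/-- Points of the plane. -/
abbrev Pt : Type := ℝ × ℝ

/-- The closed unit disk `D² = {x² + y² ≤ 1}`. -/
def diskD : Set Pt := {p | p.1 ^ 2 + p.2 ^ 2 ≤ 1}

/-- The origin `O = (0,0)`. -/
def ptO : Pt := (0, 0)

/-- The boundary circle `∂D² = {x² + y² = 1}`. -/
def bdD : Set Pt := {p | p.1 ^ 2 + p.2 ^ 2 = 1}

/-- A TC ("topological center") flow on the disk `D²`: a `C^∞` vector field `F` on `D²`
together with its flow `φ`, such that `O` is the unique singular point of `F` in `D²`,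
the boundary circle is an orbit, and every nonsingular point is periodic. -/
structure TCFlow where
  /-- the vector field -/
  F : Pt → Pt
  /-- the flow of `F` -/
  φ : Pt → ℝ → Pt
  F_smooth : ContDiffOn ℝ (⊤ : ℕ∞) F diskD
  φ_smooth : ContDiffOn ℝ (⊤ : ℕ∞) (fun p : Pt × ℝ => φ p.1 p.2) (diskD ×ˢ (univ : Set ℝ))
  φ_mapsTo : ∀ z ∈ diskD, ∀ t : ℝ, φ z t ∈ diskD
  φ_zero : ∀ z ∈ diskD, φ z 0 = z
  φ_add : ∀ z ∈ diskD, ∀ s t : ℝ, φ (φ z s) t = φ z (s + t)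
  φ_deriv : ∀ z ∈ diskD, ∀ t : ℝ, HasDerivAt (φ z) (F (φ z t)) t
  F_zero_iff : ∀ z ∈ diskD, (F z = 0 ↔ z = ptO)
  bd_orbit : ∀ z ∈ bdD, {p : Pt | ∃ t : ℝ, φ z t = p} = bdD
  periodic : ∀ z ∈ diskD, z ≠ ptO → ∃ t : ℝ, 0 < t ∧ φ z t = z

/-- The orbit of a point under the flow. -/
def orb (Φ : TCFlow) (z : Pt) : Set Pt := Set.range (Φ.φ z)

/-- `h ∈ E(F)`: a `C^∞` self-map of `D²` preserving each orbit of `F` and restricting to a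
`C^∞` diffeomorphism between some open neighbourhoods of `O` in `D²`. -/
def Emem (Φ : TCFlow) (h : Pt → Pt) : Prop :=
  Set.MapsTo h diskD diskD ∧
  ContDiffOn ℝ (⊤ : ℕ∞) h diskD ∧
  (∀ z ∈ diskD, h '' orb Φ z = orb Φ z) ∧
  (∃ U V : Set Pt, IsOpen U ∧ IsOpen V ∧ ptO ∈ U ∧ ptO ∈ V ∧ U ⊆ diskD ∧ V ⊆ diskD ∧
    Set.BijOn h U V ∧
    ∃ g : Pt → Pt, ContDiffOn ℝ (⊤ : ℕ∞) g V ∧ ∀ z ∈ U, g (h z) = z)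

/-- `h ∈ E⁺(F)`: an element of `E(F)` with positive Jacobian determinant at `O`. -/
def EplMem (Φ : TCFlow) (h : Pt → Pt) : Prop :=
  Emem Φ h ∧ 0 < LinearMap.det ((fderiv ℝ h ptO) : Pt →ₗ[ℝ] Pt)

/-- `h ∈ E^∂(F)`: an element of `E⁺(F)` fixed on the boundary circle. -/
def EbdMem (Φ : TCFlow) (h : Pt → Pt) : Prop :=
  EplMem Φ h ∧ ∀ z ∈ bdD, h z = z

/-- `h ∈ D(F)`: an element of `E(F)` which is a `C^∞` diffeomorphism of `D²` onto itself. -/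
def DmemTC (Φ : TCFlow) (h : Pt → Pt) : Prop :=
  Emem Φ h ∧ Set.BijOn h diskD diskD ∧
  ∃ g : Pt → Pt, ContDiffOn ℝ (⊤ : ℕ∞) g diskD ∧
    (∀ z ∈ diskD, g (h z) = z) ∧ (∀ z ∈ diskD, h (g z) = z)

/-- `h ∈ D⁺(F) = D(F) ∩ E⁺(F)`. -/
def DplMem (Φ : TCFlow) (h : Pt → Pt) : Prop := DmemTC Φ h ∧ EplMem Φ h

/-- `h ∈ D^∂(F) = D(F) ∩ E^∂(F)`. -/
def DbdMem (Φ : TCFlow) (h : Pt → Pt) : Prop := DmemTC Φ h ∧ EbdMem Φ h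

/-- `h ∈ Sh(F)`: `h` is the shift along orbits of `F` via some `C^∞` function
`α : D² → ℝ`. -/
def ShMem (Φ : TCFlow) (h : Pt → Pt) : Prop :=
  ∃ α : Pt → ℝ, ContDiffOn ℝ (⊤ : ℕ∞) α diskD ∧ ∀ z ∈ diskD, h z = Φ.φ z (α z)

/-- A first strong integral for a TC flow: a continuous function `f : D² → [0,1]`, `C^∞`
and without critical points on `D² ∖ {O}`, with `f⁻¹(0) = {O}`, `f⁻¹(1) = ∂D²`, and whose
level sets are exactly the orbits of the flow. -/
def FirstStrongIntegral (Φ : TCFlow) (f : Pt → ℝ) : Prop :=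
  ContinuousOn f diskD ∧
  Set.MapsTo f diskD (Icc (0 : ℝ) 1) ∧
  ContDiffOn ℝ (⊤ : ℕ∞) f (diskD \ {ptO}) ∧
  (∀ z ∈ diskD \ {ptO}, fderivWithin ℝ f (diskD \ {ptO}) z ≠ 0) ∧
  (∀ z ∈ diskD, (f z = 0 ↔ z = ptO)) ∧
  (∀ z ∈ diskD, (f z = 1 ↔ z ∈ bdD)) ∧
  (∀ c ∈ Icc (0 : ℝ) 1, ∃ z ∈ diskD, {w ∈ diskD | f w = c} = orb Φ z)

/-- `θ` is the minimal period function of the TC flow `Φ` on `D² ∖ {O}`. -/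
def IsMinPeriod (Φ : TCFlow) (θ : Pt → ℝ) : Prop :=
  ∀ z ∈ diskD \ {ptO},
    0 < θ z ∧ Φ.φ z (θ z) = z ∧ ∀ t : ℝ, 0 < t → t < θ z → Φ.φ z t ≠ z


section Aux
open Filter Topology

theorem implicit_smooth {S : Set Pt} (hS : UniqueDiffOn ℝ S) (G : Pt × ℝ → ℝ)
    (hG : ContDiffOn ℝ (⊤ : ℕ∞) G (S ×ˢ (univ : Set ℝ))) (G' : Pt → ℝ)
    (u : Pt → ℝ) (hu : ContinuousOn u S) (h0 : ∀ z ∈ S, G (z, u z) = 0)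
    (hG' : ∀ z ∈ S, HasDerivAt (fun t => G (z, t)) (G' z) (u z))
    (hne : ∀ z ∈ S, G' z ≠ 0) : ContDiffOn ℝ (⊤ : ℕ∞) u S := by
  have hSU : UniqueDiffOn ℝ (S ×ˢ (univ : Set ℝ)) := hS.prod uniqueDiffOn_univ
  set A : Pt × ℝ → (Pt × ℝ →L[ℝ] ℝ) := fderivWithin ℝ G (S ×ˢ (univ : Set ℝ)) with hA
  have hAs : ContDiffOn ℝ (⊤ : ℕ∞) A (S ×ˢ (univ : Set ℝ)) :=
    hG.fderivWithin hSU (by simp)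
  have hAd : ∀ z ∈ S, HasFDerivWithinAt G (A (z, u z)) (S ×ˢ (univ : Set ℝ)) (z, u z) :=
    fun z hz => ((hG.differentiableOn (by simp)) (z, u z) ⟨hz, mem_univ _⟩).hasFDerivWithinAt
  have hb : ∀ z ∈ S, A (z, u z) (0, 1) = G' z := by
    intro z hz
    have h1 : HasFDerivWithinAt (fun t : ℝ => ((z, t) : Pt × ℝ))
        (ContinuousLinearMap.inr ℝ Pt ℝ) univ (u z) :=
      (hasFDerivAt_prodMk_right z (u z)).hasFDerivWithinAt
    have h2 := HasFDerivWithinAt.comp (u z) (hAd z hz) h1 (fun t _ => ⟨hz, mem_univ _⟩)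
    rw [hasFDerivWithinAt_univ] at h2
    have h3 := h2.hasDerivAt.unique (hG' z hz)
    simpa using h3
  set B : Pt → (Pt →L[ℝ] ℝ) := fun z =>
    (-(A (z, u z) (0, 1))⁻¹) • ((A (z, u z)).comp (ContinuousLinearMap.inl ℝ Pt ℝ)) with hB
  have hder : ∀ z ∈ S, HasFDerivWithinAt u (B z) S z := by
    intro z hz
    have hbz : A (z, u z) (0, 1) ≠ 0 := by rw [hb z hz]; exact hne z hz
    set b := A (z, u z) (0, 1) with hbdef
    have hP : HasFDerivWithinAt (fun p : Pt × ℝ => ((p.1, G p) : Pt × ℝ))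
        ((ContinuousLinearMap.fst ℝ Pt ℝ).prod (A (z, u z))) (S ×ˢ (univ : Set ℝ)) (z, u z) :=
      hasFDerivWithinAt_fst.prodMk (hAd z hz)
    have hh : HasFDerivWithinAt (fun w : Pt => ((w, 0) : Pt × ℝ))
        (ContinuousLinearMap.inl ℝ Pt ℝ) S z :=
      (hasFDerivAt_prodMk_left z (0:ℝ)).hasFDerivWithinAt
    have hcont : Tendsto (fun w => ((w, u w) : Pt × ℝ)) (𝓝[S] z)
        (𝓝[S ×ˢ (univ : Set ℝ)] (z, u z)) := by
      apply tendsto_nhdsWithin_of_tendsto_nhds_of_eventually_within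
      · exact ((continuousWithinAt_id).prodMk (hu z hz))
      · filter_upwards [self_mem_nhdsWithin] with w hw using ⟨hw, mem_univ _⟩
    have hres := HasFDerivWithinAt.of_comp_of_leftInverse (g := fun w => ((w, u w) : Pt × ℝ))
      (f := fun p : Pt × ℝ => ((p.1, G p) : Pt × ℝ)) (h := fun w : Pt => ((w, 0) : Pt × ℝ))
      (f'symm := (ContinuousLinearMap.fst ℝ Pt ℝ).prod
        (b⁻¹ • (ContinuousLinearMap.snd ℝ Pt ℝ -
          (A (z, u z)).comp ((ContinuousLinearMap.inl ℝ Pt ℝ).comp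
            (ContinuousLinearMap.fst ℝ Pt ℝ)))))
      hcont hP hh (by
        filter_upwards [self_mem_nhdsWithin] with w hw
        simp [h0 w hw]) (by
        rintro ⟨x, t⟩
        have hsplit : A (z, u z) (x, t) = A (z, u z) (x, 0) + t * b := by
          have : ((x, t) : Pt × ℝ) = (x, 0) + t • ((0, 1) : Pt × ℝ) := by
            simp
          rw [this, map_add, map_smul, smul_eq_mul]
        ext
        · simp
        · simp
        · simp [hsplit]
          field_simp) hz
    have := hres.snd
    refine this.congr_fderiv ?_
    ext <;> simp [hB, ← hbdef]
  rw [contDiffOn_infty]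
  intro n
  induction n with
  | zero => simpa using hu
  | succ n ih =>
    push_cast
    rw [contDiffOn_succ_iff_hasFDerivWithinAt_of_uniqueDiffOn hS]
    refine ⟨(by intro h; simp at h), B, ?_, hder⟩
    have hAu : ContDiffOn ℝ n (fun z => A (z, u z)) S :=
      ContDiffOn.comp (hAs.of_le (by exact_mod_cast le_top)) (contDiffOn_id.prodMk ih)
        (fun z hz => ⟨hz, mem_univ _⟩)
    have h1 : ContDiffOn ℝ n (fun z => A (z, u z) (0, 1)) S := hAu.clm_apply contDiffOn_const
    have h2 : ContDiffOn ℝ n (fun z => -(A (z, u z) (0, 1))⁻¹) S :=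
      (h1.inv (fun z hz => by rw [hb z hz]; exact hne z hz)).neg
    exact ContDiffOn.smul h2 (hAu.clm_comp contDiffOn_const)

theorem disk_convex : Convex ℝ diskD := by
  intro p hp q hq a b ha hb hab
  simp only [diskD, mem_ofPred_eq, Prod.fst_add, Prod.snd_add, Prod.smul_fst, Prod.smul_snd,
    smul_eq_mul] at *
  have h1 : b = 1 - a := by linarith
  subst h1
  nlinarith [mul_nonneg ha hb, sq_nonneg (p.1 - q.1), sq_nonneg (p.2 - q.2),
    mul_nonneg (mul_nonneg ha hb) (add_nonneg (sq_nonneg (p.1 - q.1)) (sq_nonneg (p.2 - q.2)))]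

theorem disk_closed : IsClosed diskD :=
  isClosed_le (by fun_prop) (by fun_prop)

theorem disk_compact : IsCompact diskD := by
  refine (isCompact_Icc (a := ((-1, -1) : Pt)) (b := (1, 1))).of_isClosed_subset disk_closed ?_
  intro p hp
  simp only [diskD, mem_ofPred_eq] at hp
  refine ⟨⟨?_, ?_⟩, ⟨?_, ?_⟩⟩ <;> simp <;> nlinarith [sq_nonneg p.1, sq_nonneg p.2]

theorem odisk_open : IsOpen {p : Pt | p.1 ^ 2 + p.2 ^ 2 < 1} :=
  isOpen_lt (by fun_prop) (by fun_prop)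

theorem odisk_sub : {p : Pt | p.1 ^ 2 + p.2 ^ 2 < 1} ⊆ diskD := fun p hp => by
  simp only [diskD, mem_ofPred_eq] at *; exact hp.le

theorem odisk_mem : ptO ∈ {p : Pt | p.1 ^ 2 + p.2 ^ 2 < 1} := by simp [ptO]

theorem ptO_mem : ptO ∈ diskD := odisk_sub odisk_mem

theorem disk_uniq : UniqueDiffOn ℝ diskD :=
  uniqueDiffOn_convex disk_convex ⟨ptO, interior_maximal odisk_sub odisk_open odisk_mem⟩

theorem disk_inter_uniq {W : Set Pt} (hW : IsOpen W) : UniqueDiffOn ℝ (diskD ∩ W) :=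
  disk_uniq.inter hW

/-- one-dimensional diffeos -/
theorem line_diffeo (ρ : ℝ) (hρ : 0 < ρ) : ∃ r > 0, ∀ β : ℝ, |β| < r →
    ∃ μ ν : ℝ → ℝ, ContDiff ℝ (⊤ : ℕ∞) μ ∧ ContDiff ℝ (⊤ : ℕ∞) ν ∧ StrictMono μ ∧ StrictMono ν ∧
      (∀ s, ν (μ s) = s) ∧ (∀ s, μ (ν s) = s) ∧ (∀ s ≤ -ρ, μ s = s) ∧ (∀ s ≤ -ρ, ν s = s) ∧
      μ β = 0 := by
  set χ : ℝ → ℝ := fun s => Real.smoothTransition ((s + ρ) * (2 / ρ)) with hχ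
  have hχs : ContDiff ℝ (⊤ : ℕ∞) χ := by
    apply Real.smoothTransition.contDiff.comp
    fun_prop
  have hχ0 : ∀ s ≤ -ρ, χ s = 0 := fun s hs => by
    apply Real.smoothTransition.zero_of_nonpos
    apply mul_nonpos_of_nonpos_of_nonneg (by linarith) (by positivity)
  have hχ1 : ∀ s ≥ -ρ/2, χ s = 1 := fun s hs => by
    apply Real.smoothTransition.one_of_one_le
    rw [mul_div_assoc', le_div_iff₀ hρ]; linarith
  have hχd : Differentiable ℝ χ := hχs.differentiable (by simp)
  have hχdc : Continuous (deriv χ) := hχs.continuous_deriv (by simp)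
  obtain ⟨C, hC⟩ := (isCompact_Icc (a := -ρ) (b := 0)).exists_bound_of_continuousOn
    hχdc.continuousOn
  have hbd : ∀ s, |deriv χ s| ≤ max C 0 := by
    intro s
    by_cases h1 : s < -ρ
    · have : χ =ᶠ[𝓝 s] fun _ => 0 := by
        filter_upwards [Iio_mem_nhds h1] with x hx using hχ0 x (le_of_lt hx)
      rw [this.deriv_eq]; simp
    by_cases h2 : s > 0
    · have : χ =ᶠ[𝓝 s] fun _ => 1 := by
        filter_upwards [Ioi_mem_nhds h2] with x hx using hχ1 x (by
          have : (0:ℝ) < x := hx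
          linarith)
      rw [this.deriv_eq]; simp
    · exact le_trans (hC s ⟨by linarith, by linarith⟩) (le_max_left _ _)
  set M := max C 0 + 1 with hM
  have hM0 : 0 < M := by have := le_max_right C 0; linarith
  refine ⟨min (1 / M) (ρ / 2), by positivity, ?_⟩
  intro β hβ
  have hβ1 : |β| < 1 / M := lt_of_lt_of_le hβ (min_le_left _ _)
  have hβ2 : |β| < ρ / 2 := lt_of_lt_of_le hβ (min_le_right _ _)
  set μ : ℝ → ℝ := fun s => s - β * χ s with hμ
  have hμs : ContDiff ℝ (⊤ : ℕ∞) μ := contDiff_id.sub (contDiff_const.mul hχs)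
  have hμd : ∀ s, HasDerivAt μ (1 - β * deriv χ s) s := fun s =>
    (hasDerivAt_id s).sub ((hχd s).hasDerivAt.const_mul β)
  have hpos : ∀ s, 0 < 1 - β * deriv χ s := by
    intro s
    have : |β * deriv χ s| < 1 := by
      rw [abs_mul]
      have h1 : |β| * |deriv χ s| ≤ |β| * M :=
        mul_le_mul_of_nonneg_left ((hbd s).trans (by linarith)) (abs_nonneg _)
      rw [lt_div_iff₀ hM0] at hβ1
      linarith
    linarith [(abs_lt.1 this).2]
  have hmono : StrictMono μ := strictMono_of_deriv_pos (fun s => by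
    rw [(hμd s).deriv]; exact hpos s)
  have hχ01 : ∀ s, |χ s| ≤ 1 := fun s => by
    rw [abs_of_nonneg (Real.smoothTransition.nonneg _)]
    exact Real.smoothTransition.le_one _
  have hsurj : Function.Surjective μ := by
    have hbb : ∀ s, |β * χ s| ≤ |β| := fun s => by
      rw [abs_mul]; exact mul_le_of_le_one_right (abs_nonneg _) (hχ01 s)
    apply hμs.continuous.surjective
    · apply tendsto_atTop_mono (f := fun s => s - |β|)
      · intro s; have := (abs_le.1 (hbb s)).2; simp only [hμ]; linarith
      · exact tendsto_atTop_add_const_right _ _ tendsto_id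
    · apply tendsto_atBot_mono (f := fun s => s + |β|)
      · intro s; have := (abs_le.1 (hbb s)).1; simp only [hμ]; linarith
      · exact tendsto_atBot_add_const_right _ _ tendsto_id
  set e := hmono.orderIsoOfSurjective μ hsurj with he
  have heμ : ∀ s, e s = μ s := fun s => rfl
  refine ⟨μ, e.symm, hμs, ?_, hmono, e.symm.strictMono, fun s => e.symm_apply_apply s,
    fun s => e.apply_symm_apply s, ?_, ?_, ?_⟩
  · exact e.toHomeomorph.contDiff_symm_deriv (fun x => (hpos x).ne') hμd hμs
  · intro s hs; simp [hμ, hχ0 s hs]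
  · intro s hs
    have : μ s = s := by simp [hμ, hχ0 s hs]
    calc e.symm s = e.symm (e s) := by rw [heμ, this]
      _ = s := e.symm_apply_apply s
  · have : χ β = 1 := hχ1 β (by linarith [(abs_lt.1 hβ2).1])
    simp [hμ, this]

theorem phi_cont (Φ : TCFlow) :
    ContinuousOn (fun p : Pt × ℝ => Φ.φ p.1 p.2) (diskD ×ˢ (univ : Set ℝ)) :=
  Φ.φ_smooth.continuousOn

theorem phi_cont_left (Φ : TCFlow) (t : ℝ) : ContinuousOn (fun z => Φ.φ z t) diskD :=
  (phi_cont Φ).comp (continuousOn_id.prodMk continuousOn_const) (fun z hz => ⟨hz, mem_univ _⟩)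

theorem phi_cont_right (Φ : TCFlow) {z : Pt} (hz : z ∈ diskD) : Continuous (Φ.φ z) :=
  continuous_iff_continuousAt.2 fun t => (Φ.φ_deriv z hz t).continuousAt

theorem phi_smooth_left (Φ : TCFlow) (t : ℝ) :
    ContDiffOn ℝ (⊤ : ℕ∞) (fun z => Φ.φ z t) diskD :=
  ContDiffOn.comp Φ.φ_smooth (contDiffOn_id.prodMk contDiffOn_const)
    (fun z hz => ⟨hz, mem_univ _⟩)

theorem lev_orb {Φ : TCFlow} {f : Pt → ℝ} (hf : FirstStrongIntegral Φ f) {z w : Pt}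
    (hz : z ∈ diskD) (hw : w ∈ diskD) : f w = f z ↔ w ∈ orb Φ z := by
  obtain ⟨-, hm, -, -, -, -, hl⟩ := hf
  obtain ⟨z', hz', he⟩ := hl (f z) (hm hz)
  have h1 : z ∈ orb Φ z' := by rw [← he]; exact ⟨hz, rfl⟩
  obtain ⟨t0, ht0⟩ := h1
  have h2 : w ∈ orb Φ z' ↔ f w = f z := by
    rw [← he]; exact ⟨fun h => h.2, fun h => ⟨hw, h⟩⟩
  rw [← h2]
  constructor
  · rintro ⟨t, rfl⟩
    refine ⟨t - t0, ?_⟩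
    rw [← ht0, Φ.φ_add z' hz']; congr 1; ring
  · rintro ⟨t, rfl⟩
    refine ⟨t0 + t, ?_⟩
    rw [← ht0, Φ.φ_add z' hz']

theorem f_phi {Φ : TCFlow} {f : Pt → ℝ} (hf : FirstStrongIntegral Φ f) {z : Pt}
    (hz : z ∈ diskD) (t : ℝ) : f (Φ.φ z t) = f z :=
  (lev_orb hf hz (Φ.φ_mapsTo z hz t)).2 ⟨t, rfl⟩

def dotL (e : Pt) : Pt →L[ℝ] ℝ :=
  e.1 • ContinuousLinearMap.fst ℝ ℝ ℝ + e.2 • ContinuousLinearMap.snd ℝ ℝ ℝ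

theorem dotL_apply (e w : Pt) : dotL e w = e.1 * w.1 + e.2 * w.2 := by simp [dotL]

theorem dotL_self_pos {e : Pt} (he : e ≠ 0) : 0 < dotL e e := by
  rw [dotL_apply]
  by_contra h
  have h1 : e.1 = 0 := by nlinarith [mul_self_nonneg e.1, mul_self_nonneg e.2]
  have h2 : e.2 = 0 := by nlinarith [mul_self_nonneg e.1, mul_self_nonneg e.2]
  exact he (Prod.ext h1 h2)

theorem flowbox (Φ : TCFlow) {z0 : Pt} (hz0 : z0 ∈ diskD) (hO : z0 ≠ ptO) {N : Set Pt}
    (hN : N ∈ 𝓝 z0) {ε0 : ℝ} (hε0 : 0 < ε0) :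
    ∃ ε > 0, ε < ε0 ∧ ∃ W : Set Pt, IsOpen W ∧ z0 ∈ W ∧ ∃ u : Pt → ℝ,
      ContDiffOn ℝ (⊤ : ℕ∞) u (diskD ∩ W) ∧ ∀ y ∈ diskD ∩ W, |u y| ≤ ε ∧
        dotL (Φ.F z0) (Φ.φ y (u y)) = dotL (Φ.F z0) z0 ∧
        (∀ t, |t| ≤ ε → dotL (Φ.F z0) (Φ.φ y t) = dotL (Φ.F z0) z0 → t = u y) ∧
        (∀ t, |t| ≤ ε → Φ.φ y t ∈ N) := by
  set e := Φ.F z0 with he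
  have he0 : e ≠ 0 := fun h => hO ((Φ.F_zero_iff z0 hz0).1 h)
  have hP : ∀ᶠ w in 𝓝[diskD] z0, 0 < dotL e (Φ.F w) ∧ w ∈ N := by
    have h1 : ContinuousWithinAt (fun w => dotL e (Φ.F w)) diskD z0 :=
      (dotL e).continuous.continuousAt.comp_continuousWithinAt (Φ.F_smooth.continuousOn z0 hz0)
    exact (h1.eventually (lt_mem_nhds (dotL_self_pos he0))).and (mem_nhdsWithin_of_mem_nhds hN)
  have hT : Tendsto (fun p : Pt × ℝ => Φ.φ p.1 p.2) (𝓝[diskD ×ˢ (univ : Set ℝ)] (z0, 0))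
      (𝓝[diskD] z0) := by
    apply tendsto_nhdsWithin_of_tendsto_nhds_of_eventually_within
    · have := phi_cont Φ (z0, 0) ⟨hz0, mem_univ _⟩
      unfold ContinuousWithinAt at this
      simpa [Φ.φ_zero z0 hz0] using this
    · filter_upwards [self_mem_nhdsWithin] with p hp using Φ.φ_mapsTo _ hp.1 _
  have hQ := hT.eventually hP
  rw [nhdsWithin_prod_eq, nhdsWithin_univ] at hQ
  obtain ⟨p1, hp1, p2, hp2, hpp⟩ := eventually_prod_iff.1 hQ
  obtain ⟨δ, hδ, hδ2⟩ := Metric.eventually_nhds_iff.1 hp2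
  obtain ⟨W1, hW1o, hW1z, hW1⟩ := mem_nhdsWithin.1 hp1
  set ε := min δ ε0 / 2 with hε
  have hεpos : 0 < ε := by positivity
  have hεδ : ε < δ := by have := min_le_left δ ε0; linarith
  have hεε : ε < ε0 := by have := min_le_right δ ε0; linarith
  have hK : ∀ y ∈ diskD, y ∈ W1 → ∀ t, |t| ≤ ε → 0 < dotL e (Φ.F (Φ.φ y t)) ∧ Φ.φ y t ∈ N :=
    fun y hy hyW t ht => hpp (hW1 ⟨hyW, hy⟩) (hδ2 (by rw [Real.dist_eq, sub_zero]; linarith))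
  set G : Pt × ℝ → ℝ := fun p => dotL e (Φ.φ p.1 p.2) - dotL e z0 with hG
  have hGd : ∀ y ∈ diskD, ∀ t, HasDerivAt (fun t => G (y, t)) (dotL e (Φ.F (Φ.φ y t))) t :=
    fun y hy t => ((dotL e).hasFDerivAt.comp_hasDerivAt t (Φ.φ_deriv y hy t)).sub_const _
  have hGc : ∀ y ∈ diskD, Continuous (fun t => G (y, t)) := fun y hy =>
    continuous_iff_continuousAt.2 fun t => (hGd y hy t).continuousAt
  have hGl : ∀ t, ContinuousOn (fun y => G (y, t)) diskD := fun t =>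
    ((dotL e).continuous.comp_continuousOn (phi_cont_left Φ t)).sub continuousOn_const
  have hmono : ∀ y ∈ diskD, y ∈ W1 → StrictMonoOn (fun t => G (y, t)) (Icc (-ε) ε) := by
    intro y hy hyW
    apply strictMonoOn_of_deriv_pos (convex_Icc _ _) (hGc y hy).continuousOn
    intro t ht
    rw [interior_Icc] at ht
    rw [(hGd y hy t).deriv]
    exact (hK y hy hyW t (abs_le.2 ⟨ht.1.le, ht.2.le⟩)).1
  have hG0 : G (z0, 0) = 0 := by simp [hG, Φ.φ_zero z0 hz0]
  have hneg : G (z0, -ε) < 0 := by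
    rw [← hG0]; exact hmono z0 hz0 hW1z ⟨le_rfl, by linarith⟩ ⟨by linarith, hεpos.le⟩ (by linarith)
  have hpos : 0 < G (z0, ε) := by
    rw [← hG0]; exact hmono z0 hz0 hW1z ⟨by linarith, hεpos.le⟩ ⟨by linarith, le_rfl⟩ hεpos
  have hev : ∀ᶠ y in 𝓝[diskD] z0, G (y, -ε) < 0 ∧ 0 < G (y, ε) :=
    ((hGl (-ε) z0 hz0).eventually (gt_mem_nhds hneg)).and
      ((hGl ε z0 hz0).eventually (lt_mem_nhds hpos))
  obtain ⟨W2, hW2o, hW2z, hW2⟩ := mem_nhdsWithin.1 hev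
  have hex : ∀ y, ∃ u, y ∈ diskD ∩ (W1 ∩ W2) → u ∈ Ioo (-ε) ε ∧ G (y, u) = 0 := by
    intro y
    by_cases hy : y ∈ diskD ∩ (W1 ∩ W2)
    · obtain ⟨h1, h2⟩ := hW2 ⟨hy.2.2, hy.1⟩
      obtain ⟨u, hu, hu2⟩ := intermediate_value_Ioo (by linarith : -ε ≤ ε)
        (hGc y hy.1).continuousOn ⟨h1, h2⟩
      exact ⟨u, fun _ => ⟨hu, hu2⟩⟩
    · exact ⟨0, fun h => absurd h hy⟩
  choose u hu using hex
  refine ⟨ε, hεpos, hεε, W1 ∩ W2, hW1o.inter hW2o, ⟨hW1z, hW2z⟩, u, ?_, ?_⟩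
  · apply implicit_smooth (disk_inter_uniq (hW1o.inter hW2o)) G ?_
      (fun y => dotL e (Φ.F (Φ.φ y (u y)))) u ?_ (fun y hy => (hu y hy).2)
      (fun y hy => hGd y hy.1 _)
      (fun y hy => (hK y hy.1 hy.2.1 _ (abs_le.2 ⟨(hu y hy).1.1.le, (hu y hy).1.2.le⟩)).1.ne')
    · exact (((dotL e).contDiff.comp_contDiffOn Φ.φ_smooth).sub contDiffOn_const).mono
        (prod_mono inter_subset_left Subset.rfl)
    · intro y hy
      have hm : ∀ y' ∈ diskD ∩ (W1 ∩ W2), ∀ a ∈ Icc (-ε) ε, (G (y', a) < 0 ↔ a < u y') := by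
        intro y' hy' a ha
        have := (hmono y' hy'.1 hy'.2.1).lt_iff_lt ha (Ioo_subset_Icc_self (hu y' hy').1)
        simp only [(hu y' hy').2] at this
        exact this
      have hm2 : ∀ y' ∈ diskD ∩ (W1 ∩ W2), ∀ a ∈ Icc (-ε) ε, (0 < G (y', a) ↔ u y' < a) := by
        intro y' hy' a ha
        have := (hmono y' hy'.1 hy'.2.1).lt_iff_lt (Ioo_subset_Icc_self (hu y' hy').1) ha
        simp only [(hu y' hy').2] at this
        exact this
      have hGl' : ∀ t, ContinuousWithinAt (fun y => G (y, t)) (diskD ∩ (W1 ∩ W2)) y :=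
        fun t => (hGl t y hy.1).mono inter_subset_left
      refine tendsto_order.2 ⟨fun a ha => ?_, fun a ha => ?_⟩
      · have hI : max a (-ε) ∈ Icc (-ε) ε :=
          ⟨le_max_right _ _, max_le (ha.trans (hu y hy).1.2).le (by linarith)⟩
        have h1 : G (y, max a (-ε)) < 0 := (hm y hy _ hI).2 (max_lt ha (hu y hy).1.1)
        filter_upwards [(hGl' _).eventually (gt_mem_nhds h1), self_mem_nhdsWithin] with y' h2 h3
        exact lt_of_le_of_lt (le_max_left _ _) ((hm y' h3 _ hI).1 h2)
      · have hI : min a ε ∈ Icc (-ε) ε :=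
          ⟨le_min ((hu y hy).1.1.trans ha).le (by linarith), min_le_right _ _⟩
        have h1 : 0 < G (y, min a ε) := (hm2 y hy _ hI).2 (lt_min ha (hu y hy).1.2)
        filter_upwards [(hGl' _).eventually (lt_mem_nhds h1), self_mem_nhdsWithin] with y' h2 h3
        exact lt_of_lt_of_le ((hm2 y' h3 _ hI).1 h2) (min_le_left _ _)
  · intro y hy
    have h1 := hu y hy
    refine ⟨abs_le.2 ⟨h1.1.1.le, h1.1.2.le⟩, sub_eq_zero.1 h1.2, ?_, fun t ht =>
      (hK y hy.1 hy.2.1 t ht).2⟩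
    intro t ht h2
    apply (hmono y hy.1 hy.2.1).injOn (abs_le.1 ht) (Ioo_subset_Icc_self h1.1)
    change G (y, t) = G (y, u y)
    rw [h1.2]; exact sub_eq_zero.2 h2

theorem span_zero {e v : Pt} (he : e ≠ 0) (hv : v ≠ 0) (hev : dotL e v = 0) {w : Pt}
    (h1 : dotL e w = 0) (h2 : dotL v w = 0) : w = 0 := by
  have hee := dotL_self_pos he
  have hvv := dotL_self_pos hv
  rw [dotL_apply] at *
  have hdet : (e.1 * v.2 - e.2 * v.1) ^ 2 = (e.1*e.1+e.2*e.2) * (v.1*v.1+v.2*v.2) := by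
    have : (e.1 * v.2 - e.2 * v.1) ^ 2 = (e.1*e.1+e.2*e.2) * (v.1*v.1+v.2*v.2)
      - (e.1*v.1+e.2*v.2)^2 := by ring
    rw [this, hev]; ring
  have hd : e.1 * v.2 - e.2 * v.1 ≠ 0 := by
    intro h
    rw [h] at hdet
    have := mul_pos hee hvv
    rw [← hdet] at this; norm_num at this
  have a1 : (e.1 * v.2 - e.2 * v.1) * w.1 = 0 := by linear_combination v.2 * h1 - e.2 * h2
  have a2 : (e.1 * v.2 - e.2 * v.1) * w.2 = 0 := by linear_combination e.1 * h2 - v.1 * h1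
  exact Prod.ext (by simpa [hd] using a1) (by simpa [hd] using a2)

theorem line_pt {e v : Pt} (he : e ≠ 0) (hv : v ≠ 0) (hev : dotL e v = 0) {w z0 : Pt}
    (h1 : dotL e w = dotL e z0) : z0 + (dotL v (w - z0) / dotL v v) • v = w := by
  have hvv := dotL_self_pos hv
  have := span_zero he hv hev (w := z0 + (dotL v (w - z0) / dotL v v) • v - w) ?_ ?_
  · exact sub_eq_zero.1 this
  · rw [map_sub, map_add, map_smul, hev, h1]; simp
  · rw [map_sub, map_add, map_smul, smul_eq_mul, div_mul_cancel₀ _ hvv.ne', map_sub]; ring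

theorem transversal {Φ : TCFlow} {f : Pt → ℝ} (hf : FirstStrongIntegral Φ f) {c0 : ℝ}
    (hc : c0 ∈ Ioc (0:ℝ) 1) : ∃ z0 ∈ diskD, f z0 = c0 ∧ z0 ≠ ptO ∧ ∃ v : Pt, v ≠ 0 ∧
      dotL (Φ.F z0) v = 0 ∧ ∃ ρ > 0,
      (∀ s ∈ Ioc (-ρ) 0, z0 + s • v ∈ diskD) ∧
      StrictMonoOn (fun s : ℝ => f (z0 + s • v)) {s : ℝ | |s| < ρ ∧ z0 + s • v ∈ diskD} ∧
      (c0 < 1 → ∀ s, |s| < ρ → z0 + s • v ∈ diskD) := by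
  have hf' := hf
  obtain ⟨hfc, hfm, hfs, hfd, hf0, hf1, hl⟩ := hf
  obtain ⟨z0, hz0, hlz⟩ := hl c0 ⟨hc.1.le, hc.2⟩
  have hz0c : f z0 = c0 := by
    have : z0 ∈ orb Φ z0 := ⟨0, Φ.φ_zero z0 hz0⟩
    rw [← hlz] at this; exact this.2
  have hO : z0 ≠ ptO := fun h => by
    have := (hf0 z0 hz0).2 h; linarith [hc.1]
  set e := Φ.F z0 with he
  have he0 : e ≠ 0 := fun h => hO ((Φ.F_zero_iff z0 hz0).1 h)
  have hU : UniqueDiffOn ℝ (diskD \ {ptO}) := disk_inter_uniq isOpen_compl_singleton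
  set A := fderivWithin ℝ f (diskD \ {ptO}) z0 with hA
  have hz0' : z0 ∈ diskD \ {ptO} := ⟨hz0, hO⟩
  have hdf : ∀ w ∈ diskD \ {ptO},
      HasFDerivWithinAt f (fderivWithin ℝ f (diskD \ {ptO}) w) (diskD \ {ptO}) w :=
    fun w hw => (hfs.differentiableOn (by simp) w hw).hasFDerivWithinAt
  have hAe : A e = 0 := by
    have h1 : HasDerivWithinAt (Φ.φ z0) e univ 0 := by
      have := Φ.φ_deriv z0 hz0 0
      rw [Φ.φ_zero z0 hz0] at this; exact this.hasDerivWithinAt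
    have h2 := HasFDerivWithinAt.comp_hasDerivWithinAt (t := diskD \ {ptO}) (l := f) (l' := A)
      (f := Φ.φ z0) (f' := e) (s := univ) (0:ℝ)
      (by rw [Φ.φ_zero z0 hz0]; exact hdf z0 hz0') h1 (by
        intro t _
        refine ⟨Φ.φ_mapsTo z0 hz0 t, fun h => ?_⟩
        have h3 := f_phi hf' hz0 t
        rw [(hf0 _ (Φ.φ_mapsTo z0 hz0 t)).2 h] at h3
        linarith [hc.1])
    have h3 : f ∘ Φ.φ z0 = fun _ => c0 := by
      funext t; simp [f_phi hf' hz0 t, hz0c]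
    rw [h3, hasDerivWithinAt_univ] at h2
    exact h2.unique (hasDerivAt_const 0 c0)
  set v0 : Pt := (-e.2, e.1) with hv0
  have hAv0 : A v0 ≠ 0 := by
    intro h
    apply hfd z0 hz0'
    have hee := dotL_self_pos he0
    rw [dotL_apply] at hee
    have key : ∀ w : Pt, A w = 0 := by
      intro w
      have : (e.1*e.1+e.2*e.2) • w = (e.1*w.1+e.2*w.2) • e + (e.1*w.2-e.2*w.1) • v0 := by
        ext <;> simp [hv0] <;> ring
      have h5 := congrArg A this
      rw [map_add, map_smul, map_smul, map_smul, hAe, h] at h5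
      simpa [hee.ne'] using h5
    exact ContinuousLinearMap.ext key
  set v : Pt := (A v0) • v0 with hv
  have hAv : 0 < A v := by
    rw [hv, map_smul, smul_eq_mul]; exact mul_self_pos.2 hAv0
  have hvne : v ≠ 0 := fun h => by rw [h, map_zero] at hAv; exact lt_irrefl _ hAv
  have hev : dotL e v = 0 := by rw [hv, map_smul, dotL_apply, hv0]; simp; right; ring
  -- strict monotonicity
  have hγ : Continuous (fun s : ℝ => z0 + s • v) := by fun_prop
  have hγd : ∀ s : ℝ, HasDerivAt (fun s : ℝ => z0 + s • v) v s := fun s => by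
    simpa using ((hasDerivAt_id s).smul_const v).const_add z0
  have hconv : ∀ r : ℝ, Convex ℝ {s : ℝ | |s| < r ∧ z0 + s • v ∈ diskD} := by
    intro r s hs t ht a b ha hb hab
    refine ⟨?_, ?_⟩
    · have := (convex_Ioo (-r) r) (abs_lt.1 hs.1) (abs_lt.1 ht.1) ha hb hab
      exact abs_lt.2 this
    · have := disk_convex hs.2 ht.2 ha hb hab
      convert this using 1
      have h1 : b = 1 - a := by linarith
      subst h1
      ext <;> simp <;> ring
  have hevp : ∀ᶠ w in 𝓝[diskD \ {ptO}] z0, 0 < fderivWithin ℝ f (diskD \ {ptO}) w v := by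
    have h1 : ContinuousOn (fun w => fderivWithin ℝ f (diskD \ {ptO}) w v) (diskD \ {ptO}) :=
      (hfs.continuousOn_fderivWithin hU (by simp)).clm_apply continuousOn_const
    exact (h1 z0 hz0').eventually (lt_mem_nhds hAv)
  obtain ⟨W, hWo, hWz, hW⟩ := mem_nhdsWithin.1 hevp
  have hev1 : ∀ᶠ s : ℝ in 𝓝 0, z0 + s • v ∈ W ∧ z0 + s • v ≠ ptO := by
    have h1 : Tendsto (fun s : ℝ => z0 + s • v) (𝓝 0) (𝓝 z0) := by
      simpa using hγ.tendsto 0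
    exact (h1.eventually (hWo.mem_nhds hWz)).and (h1.eventually (isOpen_ne.mem_nhds hO))
  obtain ⟨ρ1, hρ1, hρ1'⟩ := Metric.eventually_nhds_iff.1 hev1
  have hρ1s : ∀ s : ℝ, |s| < ρ1 → z0 + s • v ∈ W ∧ z0 + s • v ≠ ptO := fun s hs =>
    hρ1' (by simpa [Real.dist_eq] using hs)
  have hmono : StrictMonoOn (fun s : ℝ => f (z0 + s • v))
      {s : ℝ | |s| < ρ1 ∧ z0 + s • v ∈ diskD} := by
    apply strictMonoOn_of_deriv_pos (hconv ρ1)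
    · exact hfc.comp hγ.continuousOn (fun s hs => hs.2)
    · intro s hs
      have hsJ := interior_subset hs
      have h1 := hρ1s s hsJ.1
      have h2 := HasFDerivWithinAt.comp_hasDerivWithinAt (t := diskD \ {ptO}) (l := f)
        (l' := fderivWithin ℝ f (diskD \ {ptO}) (z0 + s • v))
        (f := fun s : ℝ => z0 + s • v) (f' := v) (s := {s : ℝ | |s| < ρ1 ∧ z0 + s • v ∈ diskD}) s
        (hdf _ ⟨hsJ.2, h1.2⟩) (hγd s).hasDerivWithinAt
        (fun t ht => ⟨ht.2, (hρ1s t ht.1).2⟩)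
      have h3 := h2.hasDerivAt (mem_interior_iff_mem_nhds.1 hs)
      have h4 : deriv (fun s : ℝ => f (z0 + s • v)) s
        = fderivWithin ℝ f (diskD \ {ptO}) (z0 + s • v) v := h3.deriv
      rw [h4]
      exact hW ⟨h1.1, hsJ.2, h1.2⟩
  refine ⟨z0, hz0, hz0c, hO, v, hvne, hev, ?_⟩
  have hfin : ∀ ρ2 : ℝ, 0 < ρ2 → (∀ s ∈ Ioc (-ρ2) 0, z0 + s • v ∈ diskD) →
      (c0 < 1 → ∀ s, |s| < ρ2 → z0 + s • v ∈ diskD) → ∃ ρ > 0,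
      (∀ s ∈ Ioc (-ρ) 0, z0 + s • v ∈ diskD) ∧
      StrictMonoOn (fun s : ℝ => f (z0 + s • v)) {s : ℝ | |s| < ρ ∧ z0 + s • v ∈ diskD} ∧
      (c0 < 1 → ∀ s, |s| < ρ → z0 + s • v ∈ diskD) := by
    intro ρ2 hρ2 ha hb
    refine ⟨min ρ1 ρ2, lt_min hρ1 hρ2, fun s hs => ha s ⟨?_, hs.2⟩, hmono.mono ?_, fun h s hs =>
      hb h s (lt_of_lt_of_le hs (min_le_right _ _))⟩
    · have := min_le_right ρ1 ρ2; linarith [hs.1]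
    · intro s hs; exact ⟨lt_of_lt_of_le hs.1 (min_le_left _ _), hs.2⟩
  by_cases hc1 : c0 < 1
  · have hz0o : z0 ∈ {p : Pt | p.1 ^ 2 + p.2 ^ 2 < 1} := by
      have hz0D : z0.1 ^ 2 + z0.2 ^ 2 ≤ 1 := hz0
      refine lt_of_le_of_ne hz0D (fun h => ?_)
      have := (hf1 z0 hz0).2 h; linarith
    have hev2 : ∀ᶠ s : ℝ in 𝓝 0, z0 + s • v ∈ {p : Pt | p.1 ^ 2 + p.2 ^ 2 < 1} := by
      have h1 : Tendsto (fun s : ℝ => z0 + s • v) (𝓝 0) (𝓝 z0) := by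
        simpa using hγ.tendsto 0
      exact h1.eventually (odisk_open.mem_nhds hz0o)
    obtain ⟨ρ2, hρ2, hρ2'⟩ := Metric.eventually_nhds_iff.1 hev2
    have hall : ∀ s : ℝ, |s| < ρ2 → z0 + s • v ∈ diskD := fun s hs =>
      odisk_sub (hρ2' (by simpa [Real.dist_eq] using hs))
    refine hfin ρ2 hρ2 (fun s hs => hall s (abs_lt.2 ⟨hs.1, by linarith [hs.2]⟩)) (fun _ => hall)
  · have hc1' : c0 = 1 := le_antisymm hc.2 (not_lt.1 hc1)
    have hbd : z0 ∈ bdD := (hf1 z0 hz0).1 (by rw [hz0c, hc1'])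
    have hez : dotL e z0 = 0 := by
      have h1 : ∀ t, (Φ.φ z0 t).1 ^ 2 + (Φ.φ z0 t).2 ^ 2 = 1 := by
        intro t
        have : Φ.φ z0 t ∈ bdD := by
          rw [← Φ.bd_orbit z0 hbd]; exact ⟨t, rfl⟩
        exact this
      have h2 : HasDerivAt (Φ.φ z0) e 0 := by
        have := Φ.φ_deriv z0 hz0 0
        rwa [Φ.φ_zero z0 hz0] at this
      have h2a : HasDerivAt (fun t => (Φ.φ z0 t).1) e.1 0 :=
        (ContinuousLinearMap.fst ℝ ℝ ℝ).hasFDerivAt.comp_hasDerivAt 0 h2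
      have h2b : HasDerivAt (fun t => (Φ.φ z0 t).2) e.2 0 :=
        (ContinuousLinearMap.snd ℝ ℝ ℝ).hasFDerivAt.comp_hasDerivAt 0 h2
      have h3 := (h2a.pow 2).add (h2b.pow 2)
      have h4 : ((fun t => (Φ.φ z0 t).1) ^ 2 + (fun t => (Φ.φ z0 t).2) ^ 2) = fun _ => (1:ℝ) := by
        funext t; exact h1 t
      rw [h4] at h3
      have h5 := h3.unique (hasDerivAt_const 0 (1:ℝ))
      rw [Φ.φ_zero z0 hz0] at h5
      rw [dotL_apply]
      simp at h5; linarith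
    have hvv := dotL_self_pos hvne
    have hz0ne : z0 ≠ 0 := hO
    have hκ0 : dotL v z0 ≠ 0 := fun h => hz0ne (span_zero he0 hvne hev hez h)
    set κ := dotL v z0 with hκ
    have hnorm : ∀ s : ℝ, (z0 + s • v).1 ^ 2 + (z0 + s • v).2 ^ 2
        = 1 + s * (2 * κ + s * dotL v v) := by
      intro s
      have : z0.1 ^ 2 + z0.2 ^ 2 = 1 := hbd
      rw [hκ, dotL_apply, dotL_apply]
      simp only [Prod.fst_add, Prod.snd_add, Prod.smul_fst, Prod.smul_snd, smul_eq_mul]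
      linear_combination this
    have hmem : ∀ s : ℝ, s * (2 * κ + s * dotL v v) ≤ 0 → z0 + s • v ∈ diskD := by
      intro s hs
      have := hnorm s
      change _ ≤ (1:ℝ)
      linarith
    have hκpos : 0 < κ := by
      by_contra hneg
      have hκn : κ < 0 := lt_of_le_of_ne (not_lt.1 hneg) hκ0
      set s := min (ρ1 / 2) (-κ / dotL v v) with hs
      have hs0 : 0 < s := lt_min (by linarith) (div_pos (by linarith) hvv)
      have hs1 : s ≤ ρ1 / 2 := min_le_left _ _
      have hs2 : s * dotL v v ≤ -κ := by
        rw [← le_div_iff₀ hvv]; exact min_le_right _ _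
      have hsD : z0 + s • v ∈ diskD := hmem s
        (mul_nonpos_of_nonneg_of_nonpos hs0.le (by linarith))
      have h1 := hmono (a := 0) (b := s) ⟨by simpa using hρ1, by simpa using hz0⟩
        ⟨by rw [abs_of_pos hs0]; linarith, hsD⟩ hs0
      simp only [zero_smul, add_zero, hz0c] at h1
      have := (hfm hsD).2
      linarith
    refine hfin (κ / dotL v v) (div_pos hκpos hvv) (fun s hs => hmem s ?_)
      (fun h => absurd h hc1)
    have : -κ < s * dotL v v := by
      have h1 : -s < κ / dotL v v := by linarith [hs.1]
      rw [lt_div_iff₀ hvv] at h1; linarith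
    exact mul_nonpos_of_nonpos_of_nonneg hs.2 (by linarith)

theorem min_period (Φ : TCFlow) {z0 : Pt} (hz0 : z0 ∈ diskD) (hO : z0 ≠ ptO) :
    ∃ Θ > 0, Φ.φ z0 Θ = z0 ∧ ∀ t, 0 < t → t < Θ → Φ.φ z0 t ≠ z0 := by
  obtain ⟨ε, hε, -, W, hWo, hWz, u, -, hu⟩ := flowbox Φ hz0 hO (univ_mem : univ ∈ 𝓝 z0) one_pos
  obtain ⟨-, -, huniq, -⟩ := hu z0 ⟨hz0, hWz⟩
  have h0 : (0:ℝ) = u z0 := huniq 0 (by simp [hε.le]) (by rw [Φ.φ_zero z0 hz0])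
  have hsmall : ∀ t, 0 < t → t ≤ ε → Φ.φ z0 t ≠ z0 := by
    intro t ht hte h
    have := huniq t (by rw [abs_of_pos ht]; exact hte) (by rw [h])
    linarith
  obtain ⟨T, hT, hT2⟩ := Φ.periodic z0 hz0 hO
  have hTε : ε < T := by
    by_contra h; exact hsmall T hT (not_lt.1 h) hT2
  have hcl : IsClosed {t | Φ.φ z0 t = z0} := isClosed_eq (phi_cont_right Φ hz0) continuous_const
  obtain ⟨Θ, hΘ, hmin⟩ := ((isCompact_Icc (a := ε) (b := T)).inter_right hcl).exists_isLeast
    ⟨T, ⟨hTε.le, le_rfl⟩, hT2⟩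
  refine ⟨Θ, lt_of_lt_of_le hε hΘ.1.1, hΘ.2, fun t ht htΘ h => ?_⟩
  by_cases hte : t ≤ ε
  · exact hsmall t ht hte h
  · have := hmin ⟨⟨(not_le.1 hte).le, htΘ.le.trans hΘ.1.2⟩, h⟩
    linarith

structure Band (f : Pt → ℝ) (c0 : ℝ) where
  I : Set ℝ
  K : ℝ → ℝ → Pt
  m : ℝ → ℝ
  ρ : ℝ
  hρ : 0 < ρ
  hI1 : Ioc (-ρ) 0 ⊆ I
  hI2 : I ⊆ Ioo (-ρ) ρ
  hI3 : Convex ℝ I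
  mono : StrictMonoOn m I
  mcont : ContinuousOn m I
  m0 : m 0 = c0
  near : ∀ r > 0, ∀ᶠ b in 𝓝[Ioc 0 1] c0, ∃ β ∈ I, |β| < r ∧ m β = b
  Ks : ContDiffOn ℝ (⊤ : ℕ∞) (fun p : ℝ × ℝ => K p.1 p.2) (I ×ˢ univ)
  Kd : ∀ s ∈ I, ∀ t, K s t ∈ diskD
  Kf : ∀ s ∈ I, ∀ t, f (K s t) = m s
  per : ∀ s ∈ I, ∀ t t', K s t = K s t' → ∀ s' ∈ I, K s' t = K s' t'
  sec : ∀ z1 ∈ diskD, f z1 ∈ m '' I → ∃ σ : Pt → ℝ × ℝ,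
    ContDiffWithinAt ℝ (⊤ : ℕ∞) σ diskD z1 ∧
    ∀ᶠ z in 𝓝[diskD] z1, (σ z).1 ∈ I ∧ K (σ z).1 (σ z).2 = z

theorem band_exists {Φ : TCFlow} {f : Pt → ℝ} (hf : FirstStrongIntegral Φ f) {c0 : ℝ}
    (hc : c0 ∈ Ioc (0:ℝ) 1) : Nonempty (Band f c0) := by
  obtain ⟨z0, hz0, hz0c, hO, v, hv, hev, ρ0, hρ0, hIoc, hmono, hint⟩ := transversal hf hc
  obtain ⟨Θ, hΘ, hΘp, hΘm⟩ := min_period Φ hz0 hO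
  have he0 : Φ.F z0 ≠ 0 := fun h => hO ((Φ.F_zero_iff z0 hz0).1 h)
  have hvv := dotL_self_pos hv
  have hfc : ContinuousOn f diskD := hf.1
  set S : Pt → ℝ := fun w => dotL v (w - z0) / dotL v v with hS
  have hSs : ContDiff ℝ (⊤ : ℕ∞) S := by
    have : ContDiff ℝ (⊤ : ℕ∞) (fun w => dotL v (w - z0)) :=
      (dotL v).contDiff.comp (contDiff_id.sub contDiff_const)
    exact this.div_const _
  set γ : ℝ → Pt := fun s => z0 + s • v with hγ
  have hγs : ContDiff ℝ (⊤ : ℕ∞) γ := contDiff_const.add (contDiff_id.smul contDiff_const)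
  have hγc : Continuous γ := hγs.continuous
  have hγ0 : γ 0 = z0 := by simp [hγ]
  have hSγ : ∀ s, S (γ s) = s := by
    intro s; simp [hS, hγ, hvv.ne']
  have hline : ∀ w, dotL (Φ.F z0) w = dotL (Φ.F z0) z0 → γ (S w) = w :=
    fun w hw => line_pt he0 hv hev hw
  have hdγ : ∀ s, dotL (Φ.F z0) (γ s) = dotL (Φ.F z0) z0 := fun s => by
    simp only [hγ, map_add, map_smul, hev]; simp
  set J0 : Set ℝ := {s : ℝ | |s| < ρ0 ∧ γ s ∈ diskD} with hJ0
  have hN : {w : Pt | |S w| < ρ0} ∈ 𝓝 z0 := by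
    apply (isOpen_lt (hSs.continuous.abs) continuous_const).mem_nhds
    change |S z0| < ρ0
    rw [← hγ0, hSγ]; simpa using hρ0
  obtain ⟨ε, hε, hεΘ, W, hWo, hWz, u, hus, hu⟩ := flowbox Φ hz0 hO hN (half_pos hΘ)
  have h0J : (0:ℝ) ∈ J0 := ⟨by simpa using hρ0, by rw [hγ0]; exact hz0⟩
  -- choose ρ
  have hφΘ : ContinuousWithinAt (fun s => Φ.φ (γ s) Θ) J0 0 :=
    ((phi_cont_left Φ Θ).comp hγc.continuousOn (fun s hs => hs.2)) 0 h0J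
  have hev1 : ∀ᶠ s in 𝓝[J0] 0, γ s ∈ W ∧ Φ.φ (γ s) Θ ∈ W := by
    refine ((hγc.continuousAt.continuousWithinAt).eventually
      (hWo.mem_nhds (by rw [hγ0]; exact hWz))).and
      (hφΘ.eventually (hWo.mem_nhds
        (by change Φ.φ (γ 0) Θ ∈ W; rw [hγ0, hΘp]; exact hWz)))
  have hev2 : ∀ᶠ s in 𝓝 (0:ℝ), ∀ t ∈ Icc ε (Θ - ε), s ∈ J0 → Φ.φ (γ s) t ≠ γ s := by
    apply isCompact_Icc.eventually_forall_of_forall_eventually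
    intro t ht
    have hc1 : ContinuousWithinAt (fun p : ℝ × ℝ => Φ.φ (γ p.1) p.2 - γ p.1)
        (J0 ×ˢ univ) (0, t) := by
      apply ContinuousWithinAt.sub
      · exact ((phi_cont Φ).comp (s := J0 ×ˢ univ) (f := fun p : ℝ × ℝ => (γ p.1, p.2))
          (Continuous.continuousOn (by fun_prop)) (fun p hp => ⟨hp.1.2, mem_univ _⟩))
          (0, t) ⟨h0J, mem_univ _⟩
      · exact Continuous.continuousWithinAt (by fun_prop)
    have hne : Φ.φ (γ (0, t).1) (0, t).2 - γ (0, t).1 ≠ 0 := by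
      rw [sub_ne_zero]
      simp only [hγ0]
      exact hΘm t (by linarith [ht.1]) (by linarith [ht.2])
    have := hc1.eventually (isOpen_ne.mem_nhds hne)
    rw [eventually_nhdsWithin_iff] at this
    filter_upwards [this] with p hp hpJ h
    exact hp ⟨hpJ, mem_univ _⟩ (sub_eq_zero.2 h)
  obtain ⟨ρ1, hρ1, hρ1'⟩ := Metric.eventually_nhds_iff.1
    ((eventually_nhdsWithin_iff.1 hev1).and hev2)
  set ρ := min ρ0 ρ1 with hρdef
  have hρ : 0 < ρ := lt_min hρ0 hρ1
  set I : Set ℝ := {s : ℝ | |s| < ρ ∧ γ s ∈ diskD} with hI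
  have hIJ : I ⊆ J0 := fun s hs => ⟨lt_of_lt_of_le hs.1 (min_le_left _ _), hs.2⟩
  have hIW : ∀ s ∈ I, γ s ∈ diskD ∩ W ∧ Φ.φ (γ s) Θ ∈ diskD ∩ W ∧
      ∀ t ∈ Icc ε (Θ - ε), Φ.φ (γ s) t ≠ γ s := by
    intro s hs
    have h1 := hρ1' (y := s) (by
      rw [Real.dist_eq, sub_zero]; exact lt_of_lt_of_le hs.1 (min_le_right _ _))
    have h2 := h1.1 (hIJ hs)
    exact ⟨⟨hs.2, h2.1⟩, ⟨Φ.φ_mapsTo _ hs.2 _, h2.2⟩, fun t ht => h1.2 t ht (hIJ hs)⟩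
  have hu0 : ∀ s ∈ I, u (γ s) = 0 := by
    intro s hs
    refine ((hu _ (hIW s hs).1).2.2.1 0 (by simpa using hε.le) ?_).symm
    rw [Φ.φ_zero _ hs.2]; exact hdγ s
  -- points returning to the section
  have hret : ∀ y ∈ diskD ∩ W, ∀ t, |t| ≤ ε → dotL (Φ.F z0) (Φ.φ y t) = dotL (Φ.F z0) z0 →
      S (Φ.φ y t) ∈ J0 ∧ γ (S (Φ.φ y t)) = Φ.φ y t := by
    intro y hy t ht h
    have h1 := hline _ h
    refine ⟨⟨(hu y hy).2.2.2 t ht, ?_⟩, h1⟩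
    rw [h1]; exact Φ.φ_mapsTo _ hy.1 _
  set θ : ℝ → ℝ := fun s => Θ + u (Φ.φ (γ s) Θ) with hθ
  have hθs : ContDiffOn ℝ (⊤ : ℕ∞) θ I := by
    apply contDiffOn_const.add
    refine hus.comp (t := diskD ∩ W) ?_ (fun s hs => (hIW s hs).2.1)
    exact (phi_smooth_left Φ Θ).comp hγs.contDiffOn (fun s hs => hs.2)
  have hθpos : ∀ s ∈ I, 0 < θ s := by
    intro s hs
    have := (abs_le.1 (hu _ (hIW s hs).2.1).1).1
    simp only [hθ]; linarith
  have hθp : ∀ s ∈ I, Φ.φ (γ s) (θ s) = γ s := by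
    intro s hs
    have hy := (hIW s hs).2.1
    obtain ⟨h1, h2, h3, h4⟩ := hu _ hy
    have h5 := hret _ hy _ h1 h2
    rw [Φ.φ_add _ hs.2] at h5
    change S (Φ.φ (γ s) (θ s)) ∈ J0 ∧ γ (S (Φ.φ (γ s) (θ s))) = Φ.φ (γ s) (θ s) at h5
    have h6 : f (γ (S (Φ.φ (γ s) (θ s)))) = f (γ s) := by rw [h5.2, f_phi hf hs.2]
    have h7 := hmono.injOn h5.1 (hIJ hs) h6
    rw [← h5.2, h7]
  have hperiodic : ∀ s ∈ I, Function.Periodic (Φ.φ (γ s)) (θ s) := by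
    intro s hs t
    rw [add_comm, ← Φ.φ_add _ hs.2, hθp s hs]
  have hmult : ∀ s ∈ I, ∀ τ, Φ.φ (γ s) τ = γ s → ∃ k : ℤ, τ = k * θ s := by
    intro s hs τ hτ
    have hpos := hθpos s hs
    set k : ℤ := ⌊τ / θ s⌋ with hk
    set r := τ - k * θ s with hr
    have hr0 : 0 ≤ r := by
      have := Int.floor_le (τ / θ s)
      rw [le_div_iff₀ hpos] at this; simp only [hr]; linarith
    have hr1 : r < θ s := by
      have := Int.lt_floor_add_one (τ / θ s)
      rw [div_lt_iff₀ hpos] at this; simp only [hr]; linarith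
    have hφr : Φ.φ (γ s) r = γ s := by
      rw [hr, (hperiodic s hs).sub_int_mul_eq k, hτ]
    refine ⟨k, ?_⟩
    rcases hr0.eq_or_lt with h | h
    · rw [hr] at h; linarith
    exfalso
    obtain ⟨hy1, hy2, htube⟩ := hIW s hs
    by_cases h1 : r ≤ ε
    · have := (hu _ hy1).2.2.1 r (by rw [abs_of_pos h]; exact h1) (by rw [hφr]; exact hdγ s)
      rw [hu0 s hs] at this; linarith
    by_cases h2 : r ≤ Θ - ε
    · exact htube r ⟨(not_le.1 h1).le, h2⟩ hφr
    have h3 : θ s ≤ Θ + ε := by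
      have := (abs_le.1 (hu _ hy2).1).2
      simp only [hθ]; linarith
    have := (hu _ hy2).2.2.1 (r - Θ) (abs_le.2 ⟨by linarith, by linarith⟩) (by
      rw [Φ.φ_add _ hs.2]
      have : Θ + (r - Θ) = r := by ring
      rw [this, hφr]; exact hdγ s)
    have h5 : r = θ s := by simp only [hθ]; linarith
    linarith
  have hI1 : Ioc (-ρ) 0 ⊆ I := by
    intro s hs
    refine ⟨abs_lt.2 ⟨hs.1, lt_of_le_of_lt hs.2 hρ⟩, hIoc s ⟨?_, hs.2⟩⟩
    have := min_le_left ρ0 ρ1; linarith [hs.1]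
  have hI3 : Convex ℝ I := by
    intro s hs t ht a b ha hb hab
    refine ⟨?_, ?_⟩
    · have := (convex_Ioo (-ρ) ρ) (abs_lt.1 hs.1) (abs_lt.1 ht.1) ha hb hab
      exact abs_lt.2 this
    · have := disk_convex hs.2 ht.2 ha hb hab
      convert this using 1
      have h1 : b = 1 - a := by linarith
      subst h1
      ext <;> simp [hγ] <;> ring
  have hmI : StrictMonoOn (fun s => f (γ s)) I := hmono.mono hIJ
  have hmc : ContinuousOn (fun s => f (γ s)) I :=
    hfc.comp hγc.continuousOn (fun s hs => hs.2)
  have h0I : (0:ℝ) ∈ I := hI1 ⟨by linarith, le_rfl⟩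
  have hm0 : f (γ 0) = c0 := by rw [hγ0, hz0c]
  refine ⟨{ I := I, K := fun s t => Φ.φ (γ s) (θ s * t), m := fun s => f (γ s), ρ := ρ, hρ := hρ,
            hI1 := hI1, hI2 := fun s hs => abs_lt.1 hs.1, hI3 := hI3, mono := hmI,
            mcont := hmc, m0 := hm0, near := ?_, Ks := ?_, Kd := ?_, Kf := ?_, per := ?_,
            sec := ?_ }⟩
  · intro r hr
    set r' := min r ρ / 2 with hr'
    have hr'0 : 0 < r' := by positivity
    have hr'1 : r' < r := by have := min_le_left r ρ; linarith
    have hr'2 : r' < ρ := by have := min_le_right r ρ; linarith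
    have hlow : f (γ (-r')) < c0 := by
      rw [← hm0]
      exact hmI (hI1 ⟨by linarith, by linarith⟩) h0I (by linarith)
    have hIcc : Icc (-r') 0 ⊆ I := fun s hs => hI1 ⟨by linarith [hs.1], hs.2⟩
    have hcaseLow : ∀ b, f (γ (-r')) < b → b ≤ c0 → ∃ β ∈ I, |β| < r ∧ f (γ β) = b := by
      intro b hb1 hb2
      obtain ⟨β, hβ, hβ2⟩ := intermediate_value_Icc (by linarith : -r' ≤ 0) (hmc.mono hIcc)
        ⟨hb1.le, by rw [hm0]; exact hb2⟩
      exact ⟨β, hIcc hβ, abs_lt.2 ⟨by linarith [hβ.1], by linarith [hβ.2]⟩, hβ2⟩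
    by_cases hc1 : c0 < 1
    · have hall : ∀ s, |s| < ρ → s ∈ I := fun s hs =>
        ⟨hs, hint hc1 s (lt_of_lt_of_le hs (min_le_left _ _))⟩
      have hr'I : r' ∈ I := hall r' (by rw [abs_of_pos hr'0]; exact hr'2)
      have hhigh : c0 < f (γ r') := by
        rw [← hm0]; exact hmI h0I hr'I hr'0
      have hIcc2 : Icc 0 r' ⊆ I := fun s hs =>
        hall s (abs_lt.2 ⟨by linarith [hs.1], by linarith [hs.2]⟩)
      apply mem_nhdsWithin_of_mem_nhds
      filter_upwards [lt_mem_nhds hlow, gt_mem_nhds hhigh] with b hb1 hb2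
      rcases le_or_gt b c0 with h | h
      · exact hcaseLow b hb1 h
      · obtain ⟨β, hβ, hβ2⟩ := intermediate_value_Icc hr'0.le (hmc.mono hIcc2)
          ⟨by rw [hm0]; exact h.le, hb2.le⟩
        exact ⟨β, hIcc2 hβ, abs_lt.2 ⟨by linarith [hβ.1], by linarith [hβ.2]⟩, hβ2⟩
    · filter_upwards [mem_nhdsWithin_of_mem_nhds (lt_mem_nhds hlow), self_mem_nhdsWithin]
        with b hb1 hb2
      exact hcaseLow b hb1 (hb2.2.trans (not_lt.1 hc1))
  · refine ContDiffOn.comp Φ.φ_smooth (f := fun p : ℝ × ℝ => (γ p.1, θ p.1 * p.2)) ?_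
      (fun p hp => ⟨hp.1.2, mem_univ _⟩)
    apply ContDiffOn.prodMk
    · exact (hγs.comp contDiff_fst).contDiffOn
    · exact (hθs.comp contDiff_fst.contDiffOn (fun p hp => hp.1)).mul contDiff_snd.contDiffOn
  · intro s hs t; exact Φ.φ_mapsTo _ hs.2 _
  · intro s hs t; exact f_phi hf hs.2 _
  · intro s hs t t' h s' hs'
    have h1 : Φ.φ (γ s) (θ s * t - θ s * t') = γ s := by
      have := congrArg (fun p => Φ.φ p (-(θ s * t'))) h
      simp only [Φ.φ_add _ hs.2] at this
      rw [add_neg_cancel, Φ.φ_zero _ hs.2] at this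
      exact this
    obtain ⟨k, hk⟩ := hmult s hs _ h1
    have hk' : t = t' + k := by
      have := hθpos s hs
      have h2 : θ s * (t - t' - k) = 0 := by linarith
      rcases mul_eq_zero.1 h2 with h3 | h3
      · linarith
      · linarith
    change Φ.φ (γ s') (θ s' * t) = Φ.φ (γ s') (θ s' * t')
    have : θ s' * t = θ s' * t' + k * θ s' := by rw [hk']; ring
    rw [this]
    exact (hperiodic s' hs').int_mul k _
  · rintro z1 hz1 ⟨s1, hs1, hs1f⟩
    obtain ⟨t1, ht1⟩ := (lev_orb hf hs1.2 hz1).1 hs1f.symm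
    set y : Pt → Pt := fun z => Φ.φ z (-t1) with hy
    have hyD : ∀ z ∈ diskD, y z ∈ diskD := fun z hz => Φ.φ_mapsTo z hz _
    have hyz1 : y z1 = γ s1 := by
      simp only [hy]
      rw [← ht1, Φ.φ_add _ hs1.2, add_neg_cancel, Φ.φ_zero _ hs1.2]
    have hys : ContDiffWithinAt ℝ (⊤ : ℕ∞) y diskD z1 := phi_smooth_left Φ (-t1) z1 hz1
    have hyW : ∀ᶠ z in 𝓝[diskD] z1, y z ∈ diskD ∩ W := by
      have h1 := hys.continuousWithinAt.eventually
        (hWo.mem_nhds (by rw [hyz1]; exact (hIW s1 hs1).1.2))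
      filter_upwards [h1, self_mem_nhdsWithin] with z hz hzD using ⟨hyD z hzD, hz⟩
    have huy : ContDiffWithinAt ℝ (⊤ : ℕ∞) (fun z => u (y z)) diskD z1 :=
      ContDiffWithinAt.comp_of_preimage_mem_nhdsWithin z1
        (hus (y z1) (by rw [hyz1]; exact (hIW s1 hs1).1)) hys hyW
    have hp : ContDiffWithinAt ℝ (⊤ : ℕ∞) (fun z => Φ.φ (y z) (u (y z))) diskD z1 :=
      ContDiffWithinAt.comp z1 (g := fun p : Pt × ℝ => Φ.φ p.1 p.2)
        (f := fun z => (y z, u (y z)))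
        (Φ.φ_smooth (y z1, u (y z1)) ⟨hyD z1 hz1, mem_univ _⟩)
        (hys.prodMk huy) (fun z hz => ⟨hyD z hz, mem_univ _⟩)
    set S' : Pt → ℝ := fun z => S (Φ.φ (y z) (u (y z))) with hS'
    have hS's : ContDiffWithinAt ℝ (⊤ : ℕ∞) S' diskD z1 :=
      hSs.contDiffAt.comp_contDiffWithinAt z1 hp
    have hS'1 : S' z1 = s1 := by
      simp only [hS']
      rw [hyz1, hu0 s1 hs1, Φ.φ_zero _ hs1.2, hSγ]
    have hret' : ∀ z, y z ∈ diskD ∩ W → S' z ∈ J0 ∧ γ (S' z) = Φ.φ (y z) (u (y z)) :=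
      fun z hz => hret (y z) hz _ (hu _ hz).1 (hu _ hz).2.1
    have hS'I : ∀ᶠ z in 𝓝[diskD] z1, S' z ∈ I := by
      have h1 : ∀ᶠ z in 𝓝[diskD] z1, |S' z| < ρ :=
        (hS's.continuousWithinAt.abs).eventually (gt_mem_nhds
          (by change |S' z1| < ρ; rw [hS'1]; exact hs1.1))
      filter_upwards [h1, hyW] with z h1 h2
      exact ⟨h1, (hret' z h2).1.2⟩
    have hθS : ContDiffWithinAt ℝ (⊤ : ℕ∞) (fun z => θ (S' z)) diskD z1 :=
      ContDiffWithinAt.comp_of_preimage_mem_nhdsWithin (g := θ) (f := S') (t := I) z1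
        (hθs (S' z1) (by rw [hS'1]; exact hs1)) hS's hS'I
    refine ⟨fun z => (S' z, (t1 - u (y z)) / θ (S' z)), ?_, ?_⟩
    · apply hS's.prodMk
      apply (contDiffWithinAt_const.sub huy).div hθS
      rw [hS'1]; exact (hθpos s1 hs1).ne'
    · filter_upwards [hS'I, hyW, self_mem_nhdsWithin] with z h1 h2 h3
      refine ⟨h1, ?_⟩
      have h4 := (hθpos _ h1).ne'
      change Φ.φ (γ (S' z)) (θ (S' z) * ((t1 - u (y z)) / θ (S' z))) = z
      rw [mul_div_cancel₀ _ h4, (hret' z h2).2, Φ.φ_add _ h2.1]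
      simp only [hy]
      rw [Φ.φ_add _ h3]
      have : -t1 + (u (Φ.φ z (-t1)) + (t1 - u (Φ.φ z (-t1)))) = 0 := by ring
      rw [this, Φ.φ_zero _ h3]

def subl (f : Pt → ℝ) (a : ℝ) : Set Pt := {z | z ∈ diskD ∧ f z ≤ a}

open Classical in
def push {f : Pt → ℝ} {c0 : ℝ} (B : Band f c0) (μ : ℝ → ℝ) (z : Pt) : Pt :=
  if h : ∃ p : ℝ × ℝ, p.1 ∈ B.I ∧ B.K p.1 p.2 = z then
    B.K (μ h.choose.1) h.choose.2 else z

theorem push_K {f : Pt → ℝ} {c0 : ℝ} (B : Band f c0) (μ : ℝ → ℝ) {s t : ℝ} (hs : s ∈ B.I)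
    (hμ : μ s ∈ B.I) : push B μ (B.K s t) = B.K (μ s) t := by
  have h : ∃ p : ℝ × ℝ, p.1 ∈ B.I ∧ B.K p.1 p.2 = B.K s t := ⟨(s, t), hs, rfl⟩
  unfold push
  rw [dif_pos h]
  obtain ⟨h1, h2⟩ := h.choose_spec
  have h3 : h.choose.1 = s := by
    apply B.mono.injOn h1 hs
    rw [← B.Kf _ h1 h.choose.2, h2, B.Kf _ hs]
  rw [h3] at h2 ⊢
  exact B.per s hs _ _ h2 _ hμ

structure Adm {f : Pt → ℝ} {c0 : ℝ} (B : Band f c0) (μ : ℝ → ℝ) (β β' : ℝ) : Prop where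
  smooth : ContDiff ℝ (⊤ : ℕ∞) μ
  mono : StrictMono μ
  fix : ∀ s ≤ -(B.ρ / 2), μ s = s
  hβ : β ∈ B.I
  hβ' : β' ∈ B.I
  lb : -(B.ρ / 2) < β
  lb' : -(B.ρ / 2) < β'
  val : μ β = β'

theorem half_mem {f : Pt → ℝ} {c0 : ℝ} (B : Band f c0) : -(B.ρ / 2) ∈ B.I :=
  B.hI1 ⟨by linarith [B.hρ], by linarith [B.hρ]⟩

namespace Adm

variable {f : Pt → ℝ} {c0 : ℝ} {B : Band f c0} {μ : ℝ → ℝ} {β β' : ℝ}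

theorem memI (A : Adm B μ β β') {s : ℝ} (hs : s ∈ B.I) (hsβ : s ≤ β) :
    μ s ∈ B.I ∧ μ s ≤ β' := by
  have h1 : μ s ≤ β' := by rw [← A.val]; exact A.mono.monotone hsβ
  refine ⟨?_, h1⟩
  rcases le_total s (-(B.ρ / 2)) with h | h
  · rw [A.fix s h]; exact hs
  · have h2 : -(B.ρ / 2) ≤ μ s := by
      rw [← A.fix _ le_rfl]; exact A.mono.monotone h
    exact B.hI3.ordConnected.out (half_mem B) A.hβ' ⟨h2, h1⟩

theorem low (A : Adm B μ β β') {z : Pt} (hz : f z < B.m (-(B.ρ / 2)) ) : push B μ z = z := by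
  by_cases h : ∃ p : ℝ × ℝ, p.1 ∈ B.I ∧ B.K p.1 p.2 = z
  · obtain ⟨⟨s, t⟩, h1, h2⟩ := h
    simp only at h1 h2
    have h3 : s < -(B.ρ / 2) := by
      rw [← h2, B.Kf _ h1] at hz
      exact (B.mono.lt_iff_lt h1 (half_mem B)).1 hz
    rw [← h2, push_K B μ h1 (by rw [A.fix s h3.le]; exact h1), A.fix s h3.le]
  · unfold push; rw [dif_neg h]

theorem high {β₀ : ℝ} (A : Adm B μ β β') {z : Pt} (hz : z ∈ subl f β₀) (hβ₀ : β₀ = B.m β)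
    (h : B.m (-(B.ρ / 2)) ≤ f z) :
    f z ∈ B.m '' B.I ∧ ∃ s ∈ B.I, ∃ t, s ≤ β ∧ z = B.K s t ∧ push B μ z = B.K (μ s) t := by
  subst hβ₀
  have h0 : f z ∈ B.m '' B.I := by
    have hsub : Icc (-(B.ρ / 2)) β ⊆ B.I := B.hI3.ordConnected.out (half_mem B) A.hβ
    have := intermediate_value_Icc A.lb.le (B.mcont.mono hsub)
    obtain ⟨s, hs, hs'⟩ := this ⟨h, hz.2⟩
    exact ⟨s, hsub hs, hs'⟩
  refine ⟨h0, ?_⟩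
  obtain ⟨σ, -, hσ⟩ := B.sec z hz.1 h0
  obtain ⟨h1, h2⟩ := hσ.self_of_nhdsWithin hz.1
  have h3 : (σ z).1 ≤ β := by
    have := hz.2
    rw [← h2, B.Kf _ h1] at this
    exact (B.mono.le_iff_le h1 A.hβ).1 this
  refine ⟨_, h1, _, h3, h2.symm, ?_⟩
  conv_lhs => rw [← h2]
  exact push_K B μ h1 (A.memI h1 h3).1

theorem push_smooth (A : Adm B μ β β') (hfc : ContinuousOn f diskD) :
    ContDiffOn ℝ (⊤ : ℕ∞) (push B μ) (subl f (B.m β)) := by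
  intro z1 hz1
  have hmono : 𝓝[subl f (B.m β)] z1 ≤ 𝓝[diskD] z1 := nhdsWithin_mono _ (fun z hz => hz.1)
  rcases lt_or_ge (f z1) (B.m (-(B.ρ / 2))) with h | h
  · have h1 : ∀ᶠ z in 𝓝[subl f (B.m β)] z1, f z < B.m (-(B.ρ / 2)) :=
      hmono ((hfc z1 hz1.1).eventually (gt_mem_nhds h))
    apply contDiffWithinAt_id.congr_of_eventuallyEq
    · filter_upwards [h1] with z hz
      exact A.low hz
    · exact A.low h
  · obtain ⟨h0, -⟩ := A.high hz1 rfl h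
    obtain ⟨σ, hσs, hσ⟩ := B.sec z1 hz1.1 h0
    have hev : ∀ᶠ z in 𝓝[subl f (B.m β)] z1,
        (σ z).1 ∈ B.I ∧ μ (σ z).1 ∈ B.I ∧ push B μ z = B.K (μ (σ z).1) (σ z).2 := by
      filter_upwards [hmono hσ, self_mem_nhdsWithin] with z hz hzS
      obtain ⟨h1, h2⟩ := hz
      have h3 : (σ z).1 ≤ β := by
        have := hzS.2
        rw [← h2, B.Kf _ h1] at this
        exact (B.mono.le_iff_le h1 A.hβ).1 this
      refine ⟨h1, (A.memI h1 h3).1, ?_⟩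
      conv_lhs => rw [← h2]
      exact push_K B μ h1 (A.memI h1 h3).1
    have hself := hev.self_of_nhdsWithin hz1
    have hσs' : ContDiffWithinAt ℝ (⊤ : ℕ∞) σ (subl f (B.m β)) z1 :=
      hσs.mono (fun z hz => hz.1)
    have hg : ContDiffWithinAt ℝ (⊤ : ℕ∞) (fun z => (μ (σ z).1, (σ z).2))
        (subl f (B.m β)) z1 :=
      ContDiffWithinAt.prodMk (A.smooth.contDiffAt.comp_contDiffWithinAt z1 hσs'.fst) hσs'.snd
    have hc := ContDiffWithinAt.comp_of_preimage_mem_nhdsWithin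
      (g := fun p : ℝ × ℝ => B.K p.1 p.2) (f := fun z => (μ (σ z).1, (σ z).2))
      (t := B.I ×ˢ univ) z1
      (B.Ks _ ⟨hself.2.1, mem_univ _⟩) hg
      (by filter_upwards [hev] with z hz; exact ⟨hz.2.1, mem_univ _⟩)
    apply hc.congr_of_eventuallyEq
    · filter_upwards [hev] with z hz
      exact hz.2.2
    · exact hself.2.2

theorem push_maps (A : Adm B μ β β') :
    MapsTo (push B μ) (subl f (B.m β)) (subl f (B.m β')) := by
  intro z hz
  rcases lt_or_ge (f z) (B.m (-(B.ρ / 2))) with h | h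
  · rw [A.low h]
    exact ⟨hz.1, h.le.trans (B.mono.le_iff_le (half_mem B) A.hβ' |>.2 A.lb'.le)⟩
  · obtain ⟨-, s, hs, t, hsβ, hz', hp⟩ := A.high hz rfl h
    obtain ⟨h1, h2⟩ := A.memI hs hsβ
    rw [hp]
    refine ⟨B.Kd _ h1 _, ?_⟩
    rw [B.Kf _ h1]
    exact (B.mono.le_iff_le h1 A.hβ').2 h2

theorem push_lev (A : Adm B μ β β') {z w : Pt} (hz : z ∈ subl f (B.m β))
    (hw : w ∈ subl f (B.m β)) (hzw : f z = f w) : f (push B μ z) = f (push B μ w) := by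
  rcases lt_or_ge (f z) (B.m (-(B.ρ / 2))) with h | h
  · rw [A.low h, A.low (hzw ▸ h), hzw]
  · obtain ⟨-, s, hs, t, hsβ, hz', hp⟩ := A.high hz rfl h
    obtain ⟨-, s', hs', t', hsβ', hw', hp'⟩ := A.high hw rfl (hzw ▸ h)
    have : s = s' := by
      apply B.mono.injOn hs hs'
      rw [← B.Kf _ hs t, ← B.Kf _ hs' t', ← hz', ← hw', hzw]
    subst this
    rw [hp, hp', B.Kf _ (A.memI hs hsβ).1, B.Kf _ (A.memI hs hsβ).1]

theorem push_inv {ν : ℝ → ℝ} (A : Adm B μ β β') (hνμ : ∀ s, ν (μ s) = s)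
    (A' : Adm B ν β' β) {z : Pt}
    (hz : z ∈ subl f (B.m β)) : push B ν (push B μ z) = z := by
  rcases lt_or_ge (f z) (B.m (-(B.ρ / 2))) with h | h
  · rw [A.low h, A'.low h]
  · obtain ⟨-, s, hs, t, hsβ, hz', hp⟩ := A.high hz rfl h
    have h1 := (A.memI hs hsβ).1
    rw [hp, push_K B ν h1 (by rw [hνμ]; exact hs), hνμ, hz']

end Adm

def RelD (f : Pt → ℝ) (a b : ℝ) : Prop :=
  ∃ Ψ Ψ' : Pt → Pt, ContDiffOn ℝ (⊤ : ℕ∞) Ψ (subl f b) ∧ ContDiffOn ℝ (⊤ : ℕ∞) Ψ' (subl f a) ∧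
    MapsTo Ψ (subl f b) (subl f a) ∧ MapsTo Ψ' (subl f a) (subl f b) ∧
    (∀ z ∈ subl f b, Ψ' (Ψ z) = z) ∧ (∀ z ∈ subl f a, Ψ (Ψ' z) = z) ∧
    (∀ z ∈ subl f b, ∀ w ∈ subl f b, f z = f w → f (Ψ z) = f (Ψ w)) ∧
    (∀ z ∈ subl f a, ∀ w ∈ subl f a, f z = f w → f (Ψ' z) = f (Ψ' w)) ∧
    ∃ η > 0, ∀ z ∈ diskD, f z < η → Ψ z = z ∧ Ψ' z = z

theorem RelD.symm {f : Pt → ℝ} {a b : ℝ} (h : RelD f a b) : RelD f b a := by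
  obtain ⟨Ψ, Ψ', h1, h2, h3, h4, h5, h6, h7, h8, η, hη, h9⟩ := h
  exact ⟨Ψ', Ψ, h2, h1, h4, h3, h6, h5, h8, h7, η, hη, fun z hz hz' => (h9 z hz hz').symm⟩

theorem RelD.trans {f : Pt → ℝ} {a b c : ℝ} (h : RelD f a b) (k : RelD f b c) : RelD f a c := by
  obtain ⟨Ψ, Ψ', h1, h2, h3, h4, h5, h6, h7, h8, η, hη, h9⟩ := h
  obtain ⟨Χ, Χ', k1, k2, k3, k4, k5, k6, k7, k8, ε, hε, k9⟩ := k
  refine ⟨Ψ ∘ Χ, Χ' ∘ Ψ', h1.comp k1 k3, k2.comp h2 h4, h3.comp k3, k4.comp h4, ?_, ?_, ?_, ?_,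
    min η ε, lt_min hη hε, ?_⟩
  · intro z hz; simp only [Function.comp]; rw [h5 _ (k3 hz), k5 _ hz]
  · intro z hz; simp only [Function.comp]; rw [k6 _ (h4 hz), h6 _ hz]
  · intro z hz w hw e; exact h7 _ (k3 hz) _ (k3 hw) (k7 z hz w hw e)
  · intro z hz w hw e; exact k8 _ (h4 hz) _ (h4 hw) (h8 z hz w hw e)
  · intro z hz hzz
    obtain ⟨e1, e2⟩ := lt_min_iff.1 hzz
    obtain ⟨p1, p2⟩ := h9 z hz e1
    obtain ⟨q1, q2⟩ := k9 z hz e2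
    simp only [Function.comp]
    rw [q1, p1, p2, q2]; exact ⟨rfl, rfl⟩

theorem rel_local {Φ : TCFlow} {f : Pt → ℝ} (hf : FirstStrongIntegral Φ f) {c0 : ℝ}
    (hc : c0 ∈ Ioc (0:ℝ) 1) : ∀ᶠ b in 𝓝[Ioc 0 1] c0, RelD f c0 b := by
  obtain ⟨B⟩ := band_exists hf hc
  have hρ := B.hρ
  obtain ⟨r, hr, hline⟩ := line_diffeo (B.ρ / 2) (by linarith)
  filter_upwards [B.near (min r (B.ρ / 2)) (lt_min hr (by linarith))] with b hb
  obtain ⟨β, hβ, hβr, rfl⟩ := hb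
  obtain ⟨hβr, hβρ⟩ := lt_min_iff.1 hβr
  obtain ⟨μ, ν, hμ, hν, mμ, mν, i1, i2, f1, f2, v⟩ := hline β hβr
  have h0I : (0:ℝ) ∈ B.I := B.hI1 ⟨by linarith, le_rfl⟩
  have A : Adm B μ β 0 := ⟨hμ, mμ, f1, hβ, h0I, by linarith [(abs_lt.1 hβρ).1], by linarith, v⟩
  have A' : Adm B ν 0 β := ⟨hν, mν, f2, h0I, hβ, by linarith, by linarith [(abs_lt.1 hβρ).1],
    by rw [← v, i1]⟩
  suffices hR : RelD f (B.m 0) (B.m β) by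
    have e := B.m0
    generalize B.m 0 = a at e hR
    exact e ▸ hR
  refine ⟨push B μ, push B ν, A.push_smooth hf.1, A'.push_smooth hf.1, A.push_maps, A'.push_maps,
    fun z hz => A.push_inv i1 A' hz, fun z hz => A'.push_inv i2 A hz,
    fun z hz w hw e => A.push_lev hz hw e, fun z hz w hw e => A'.push_lev hz hw e,
    B.m (-(B.ρ / 2)), ?_, fun z hz hz' => ⟨A.low hz', A'.low hz'⟩⟩
  have h34 : -(3 * B.ρ / 4) ∈ B.I := B.hI1 ⟨by linarith, by linarith⟩
  have h1 : B.m (-(3 * B.ρ / 4)) < B.m (-(B.ρ / 2)) :=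
    B.mono h34 (half_mem B) (by linarith)
  have h2 := (hf.2.1 (B.Kd _ h34 0)).1
  rw [B.Kf _ h34] at h2
  linarith

theorem rel_all {Φ : TCFlow} {f : Pt → ℝ} (hf : FirstStrongIntegral Φ f) {a b : ℝ}
    (ha : a ∈ Ioc (0:ℝ) 1) (hb : b ∈ Ioc (0:ℝ) 1) : RelD f a b :=
  isPreconnected_Ioc.induction₂ (RelD f) (fun x hx => rel_local hf hx)
    (fun x y z _ _ _ h1 h2 => h1.trans h2) (fun x y _ _ h => h.symm) ha hb

theorem odisk_iff {Φ : TCFlow} {f : Pt → ℝ} (hf : FirstStrongIntegral Φ f) {z : Pt}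
    (hz : z ∈ diskD) : z ∈ {p : Pt | p.1 ^ 2 + p.2 ^ 2 < 1} ↔ f z ≠ 1 := by
  rw [Ne, hf.2.2.2.2.2.1 z hz]
  simp only [diskD, bdD, mem_ofPred_eq] at *
  exact ⟨fun h => h.ne, fun h => lt_of_le_of_ne hz h⟩

theorem small_subl {Φ : TCFlow} {f : Pt → ℝ} (hf : FirstStrongIntegral Φ f) {W : Set Pt}
    (hW : IsOpen W) (hO : ptO ∈ W) : ∃ δ ∈ Ioc (0:ℝ) 1, subl f δ ⊆ W := by
  have hc : IsCompact (diskD \ W) := disk_compact.diff hW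
  rcases (diskD \ W).eq_empty_or_nonempty with h | h
  · refine ⟨1, by simp, fun z hz => ?_⟩
    by_contra hw
    have : z ∈ diskD \ W := ⟨hz.1, hw⟩
    rw [h] at this; exact this
  · obtain ⟨x, hx, hmin⟩ := hc.exists_isMinOn h (hf.1.mono diff_subset)
    have hpos : 0 < f x := lt_of_le_of_ne (hf.2.1 hx.1).1 (fun e =>
      hx.2 (((hf.2.2.2.2.1 x hx.1).1 e.symm) ▸ hO))
    refine ⟨f x / 2, ⟨by linarith, by linarith [(hf.2.1 hx.1).2]⟩, fun z hz => ?_⟩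
    by_contra hw
    have h1 : f x ≤ f z := hmin ⟨hz.1, hw⟩
    linarith [hz.2]

theorem orb_iff {Φ : TCFlow} {f : Pt → ℝ} (hf : FirstStrongIntegral Φ f) {z w : Pt}
    (hz : z ∈ diskD) : w ∈ orb Φ z ↔ w ∈ diskD ∧ f w = f z := by
  constructor
  · rintro ⟨t, rfl⟩
    exact ⟨Φ.φ_mapsTo z hz t, f_phi hf hz t⟩
  · rintro ⟨h1, h2⟩
    exact (lev_orb hf hz h1).1 h2

theorem final_aux
    (Φ : TCFlow) (f : Pt → ℝ) (hf : FirstStrongIntegral Φ f)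
    (h : Pt → Pt) (hh : Emem Φ h) :
    ∃ g : Pt → Pt, DmemTC Φ g ∧
      ∃ U : Set Pt, IsOpen U ∧ ptO ∈ U ∧ U ⊆ diskD ∧ ∀ z ∈ U, h z = g z := by
  obtain ⟨hm, hs, ho, U, V, hU, hV, hOU, hOV, hUD, hVD, hbij, g0, hg0s, hg0⟩ := hh
  have hfh : ∀ z ∈ diskD, f (h z) = f z := by
    intro z hz
    have : h z ∈ orb Φ z := by
      rw [← ho z hz]; exact ⟨z, (orb_iff hf hz).2 ⟨hz, rfl⟩, rfl⟩
    exact ((orb_iff hf hz).1 this).2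
  obtain ⟨δ, hδ, hδs⟩ := small_subl hf (hU.inter hV) ⟨hOU, hOV⟩
  have hhm : MapsTo h (subl f δ) (subl f δ) := fun z hz =>
    ⟨hm hz.1, by rw [hfh z hz.1]; exact hz.2⟩
  have hg0' : ∀ w ∈ subl f δ, g0 w ∈ subl f δ ∧ f (g0 w) = f w ∧ h (g0 w) = w := by
    intro w hw
    obtain ⟨z, hz, rfl⟩ := hbij.surjOn (hδs hw).2
    rw [hg0 z hz, hfh z (hUD hz)]
    refine ⟨⟨hUD hz, ?_⟩, rfl, rfl⟩
    have := hw.2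
    rwa [hfh z (hUD hz)] at this
  obtain ⟨Ψ, Ψ', r1, r2, r3, r4, r5, r6, r7, r8, η, hη, r9⟩ :=
    rel_all hf hδ (show (1:ℝ) ∈ Ioc (0:ℝ) 1 by simp)
  have hD : subl f 1 = diskD := by
    ext z; exact ⟨fun hz => hz.1, fun hz => ⟨hz, (hf.2.1 hz).2⟩⟩
  rw [hD] at r1 r3 r4 r5 r7
  have hgs : ContDiffOn ℝ (⊤ : ℕ∞) (Ψ' ∘ h ∘ Ψ) diskD :=
    r2.comp ((hs.mono (fun z hz => hz.1)).comp r1 r3) (hhm.comp r3)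
  have hgs' : ContDiffOn ℝ (⊤ : ℕ∞) (Ψ' ∘ g0 ∘ Ψ) diskD :=
    r2.comp ((hg0s.mono (fun z hz => (hδs hz).2)).comp r1 r3)
      (fun z hz => (hg0' _ (r3 hz)).1)
  have hgm : MapsTo (Ψ' ∘ h ∘ Ψ) diskD diskD := r4.comp (hhm.comp r3)
  have hgm' : MapsTo (Ψ' ∘ g0 ∘ Ψ) diskD diskD := fun z hz => r4 (hg0' _ (r3 hz)).1
  have hfg : ∀ z ∈ diskD, f ((Ψ' ∘ h ∘ Ψ) z) = f z := by
    intro z hz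
    have := r8 _ (hhm (r3 hz)) _ (r3 hz) (hfh _ (r3 hz).1)
    rw [r5 z hz] at this
    exact this
  have hfg' : ∀ z ∈ diskD, f ((Ψ' ∘ g0 ∘ Ψ) z) = f z := by
    intro z hz
    have := r8 _ (hg0' _ (r3 hz)).1 _ (r3 hz) (hg0' _ (r3 hz)).2.1
    rw [r5 z hz] at this
    exact this
  have hinv : ∀ z ∈ diskD, (Ψ' ∘ g0 ∘ Ψ) ((Ψ' ∘ h ∘ Ψ) z) = z := by
    intro z hz
    simp only [Function.comp]
    rw [r6 _ (hhm (r3 hz)), hg0 _ (hδs (r3 hz)).1, r5 z hz]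
  have hinv' : ∀ z ∈ diskD, (Ψ' ∘ h ∘ Ψ) ((Ψ' ∘ g0 ∘ Ψ) z) = z := by
    intro z hz
    simp only [Function.comp]
    rw [r6 _ (hg0' _ (r3 hz)).1, (hg0' _ (r3 hz)).2.2, r5 z hz]
  generalize hG : Ψ' ∘ h ∘ Ψ = G at *
  generalize Ψ' ∘ g0 ∘ Ψ = G' at *
  refine ⟨G, ⟨⟨hgm, hgs, ?_, {p : Pt | p.1 ^ 2 + p.2 ^ 2 < 1}, {p : Pt | p.1 ^ 2 + p.2 ^ 2 < 1},
    odisk_open, odisk_open, odisk_mem, odisk_mem, odisk_sub, odisk_sub, ⟨?_, ?_, ?_⟩,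
    G', hgs'.mono odisk_sub, fun z hz => hinv z (odisk_sub hz)⟩,
    ⟨hgm, ?_, fun z hz => ⟨G' z, hgm' hz, hinv' z hz⟩⟩, G', hgs', hinv, hinv'⟩, ?_⟩
  · intro z hz
    ext w
    rw [orb_iff hf hz]
    constructor
    · rintro ⟨x, hx, rfl⟩
      obtain ⟨hx1, hx2⟩ := (orb_iff hf hz).1 hx
      exact ⟨hgm hx1, by rw [hfg x hx1, hx2]⟩
    · rintro ⟨hw, hwz⟩
      exact ⟨G' w, (orb_iff hf hz).2 ⟨hgm' hw, by rw [hfg' w hw, hwz]⟩, hinv' w hw⟩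
  · intro z hz
    have hzD := odisk_sub hz
    rw [odisk_iff hf (hgm hzD), hfg z hzD]
    exact (odisk_iff hf hzD).1 hz
  · intro z hz w hw e
    rw [← hinv z (odisk_sub hz), ← hinv w (odisk_sub hw), e]
  · intro z hz
    have hzD := odisk_sub hz
    refine ⟨G' z, ?_, hinv' z hzD⟩
    rw [odisk_iff hf (hgm' hzD), hfg' z hzD]
    exact (odisk_iff hf hzD).1 hz
  · intro z hz w hw e
    rw [← hinv z hz, ← hinv w hw, e]
  · refine ⟨{p : Pt | p.1 ^ 2 + p.2 ^ 2 < 1} ∩ f ⁻¹' Iio η,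
      (hf.1.mono odisk_sub).isOpen_inter_preimage odisk_open isOpen_Iio,
      ⟨odisk_mem, ?_⟩, fun z hz => odisk_sub hz.1, ?_⟩
    · change f ptO < η
      rw [(hf.2.2.2.2.1 ptO ptO_mem).2 rfl]; exact hη
    · rintro z ⟨hz, hzη⟩
      have hzD := odisk_sub hz
      rw [← hG]
      simp only [Function.comp]
      rw [(r9 z hzD hzη).1]
      exact ((r9 (h z) (hm hzD) (by rw [hfh z hzD]; exact hzη)).2).symm

end Aux

/-- every `h ∈ E(F)` coincides near `O` with some diffeomorphism
`g ∈ D(F)`. -/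
theorem Emem_eq_Dmem_near_origin
    (Φ : TCFlow) (f : Pt → ℝ) (hf : FirstStrongIntegral Φ f)
    (h : Pt → Pt) (hh : Emem Φ h) :
    ∃ g : Pt → Pt, DmemTC Φ g ∧
      ∃ U : Set Pt, IsOpen U ∧ ptO ∈ U ∧ U ⊆ diskD ∧ ∀ z ∈ U, h z = g z := by
  exact final_aux Φ f hf h hh

end
end
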